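/- Let $\mathcal V,\mathcal X,\mathcal Y$ be finite alphabets, $P_V$ a probability distribution on $\mathcal V$ and $W(y|x)$ a stochastic matrix from $\mathcal X$ to $\mathcal Y$, with product extensions $P^k$, $W^n$. All logarithms are natural. A joint source-channel code of parameters $(k,n)$ is a pair $f:\mathcal V^k\to\mathcal X^n$, $\varphi:\mathcal Y^n\to\mathcal V^k$, with error probability $p_e=\sum_{v}P^k(v)\sum_{y:\varphi(y)\neq v}W^n(y|f(v))$. In $[-\infty,+\infty]$, with the minimum over the empty set equal to $+\infty$, $-\log 0=+\infty$, and $0\cdot\infty=0$, put $$e(R,P_V)=\min_{Q:\,H(Q)\ge R}D(Q\|P_V),\qquad d_B(x,\bar x)=-\log\sum_y\sqrt{W(y|x)W(y|\bar x)},$$ $$E'_{\mathrm{ex}}(Q,R)=\min_{P_{X\bar X}:\,P_X=Q,\ I_P(X;\bar X)\le R}\ \mathbb E_P[d_B(X,\bar X)]+I_P(X;\bar X)-R,$$ where $P_{X\bar X}$ ranges over the probability distributions on $\mathcal X\times\mathcal X$. Let $t>0$, $m\ge 1$, let $\mathcal Q_m=\{Q_1,\dots,Q_m\}$ be a finite set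 of probability distributions on $\mathcal X$, and put $$E^{\mathrm{primal}}_{J,\mathrm{ex}}(t,\mathcal Q_m)=\min_{R\ge 0}\Big[t\,e(R/t,P_V)+\max_{Q\in\mathcal Q_m}E'_{\mathrm{ex}}(Q,R)\Big].$$ Then this exponent is achievable: for every $\varepsilon>0$ and all sufficiently large $n$, with $k=\lfloor tn\rfloor$, there exist a partition of $\mathcal V^k$ into $m$ disjoint (possibly empty) classes $\mathcal A_1,\dots,\mathcal A_m$, each a union of source type classes, types $Q_1^{(n)},\dots,Q_m^{(n)}$ of sequences in $\mathcal X^n$ with $|Q_c^{(n)}(x)-Q_c(x)|\le\varepsilon$ for all $c$ and $x$, and a joint source-channel code of parameters $(k,n)$ such that $f(v)$ has type $Q_c^{(n)}$ for every $c$ and every $v\in\mathcal A_c$, and $$p_e\le\exp\!\big(-n\,(E^{\mathrm{primal}}_{J,\mathrm{ex}}(t,\mathcal Q_m)-\varepsilon)\big)$$ (so $p_e=0$ if the exponent is $+\infty$). Moreover, if $t\log|\mathcal V|<\max_c H(Q_c)$, the partition can be chosen admissible, that is, with $|\mathcal A_c|\le|\mathcal T^n(Q_c^{(n)})|$ for every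 $c$, where $\mathcal T^n(Q)$ is the set of sequences in $\mathcal X^n$ of type $Q$. -/

import Mathlib

noncomputable section

/-- `W` is a discrete memoryless channel (a stochastic matrix). -/
def IsDMC {X Y : Type*} [Fintype Y] (W : X → Y → ℝ) : Prop :=
  ∀ x, W x ∈ stdSimplex ℝ Y

/-- Product extension of a distribution: `P^k(v) = ∏ P(vᵢ)`. -/
def prodDist {α : Type*} (P : α → ℝ) {k : ℕ} (v : Fin k → α) : ℝ := ∏ i, P (v i)

/-- Product extension of a channel: `W^n(y|x) = ∏ W(y_l|x_l)`. -/
def Wn {X Y : Type*} (W : X → Y → ℝ) {n : ℕ} (x : Fin n → X) (y : Fin n → Y) : ℝ :=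
  ∏ l, W (x l) (y l)

/-- Shannon entropy (natural logarithm). -/
def entH {α : Type*} [Fintype α] (P : α → ℝ) : ℝ := -∑ a, P a * Real.log (P a)

open Classical in
/-- Kullback–Leibler divergence `D(Q‖P)`, equal to `+∞` if `Q` is not absolutely continuous
with respect to `P`. -/
def KL {α : Type*} [Fintype α] (Q P : α → ℝ) : EReal :=
  if ∀ a, P a = 0 → Q a = 0 then ((∑ a, Q a * Real.log (Q a / P a) : ℝ) : EReal) else ⊤

open Classical in
/-- Empirical distribution (type) of a sequence. -/
def empDist {α : Type*} {k : ℕ} (v : Fin k → α) : α → ℝ :=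
  fun a => ((Finset.univ.filter fun i => v i = a).card : ℝ) / k

open Classical in
/-- Type class `T^k(P)`: sequences of length `k` with empirical distribution `P`. -/
def typeClass {α : Type*} [Fintype α] (k : ℕ) (P : α → ℝ) : Finset (Fin k → α) :=
  Finset.univ.filter fun v => empDist v = P

/-- `P` is a type of length-`k` sequences, i.e. `P ∈ 𝒫ₖ(α)`. -/
def IsType {α : Type*} (k : ℕ) (P : α → ℝ) : Prop :=
  ∃ v : Fin k → α, empDist v = P

/-- Source reliability function `e(R, P_V) = min_{Q : H(Q) ≥ R} D(Q‖P_V)`; the minimum over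
the empty set (`R > log |𝒱|`) is `+∞`. -/
def srcRel {V : Type*} [Fintype V] (PV : V → ℝ) (R : ℝ) : EReal :=
  sInf { z | ∃ Q ∈ stdSimplex ℝ V, R ≤ entH Q ∧ z = KL Q PV }

open Classical in
/-- Bhattacharyya distance `-log ∑_y √(W(y|x) W(y|x'))`, equal to `+∞` if the sum is zero. -/
def dB {X Y : Type*} [Fintype Y] (W : X → Y → ℝ) (x x' : X) : EReal :=
  if ∑ y, Real.sqrt (W x y * W x' y) = 0 then ⊤
  else ((-Real.log (∑ y, Real.sqrt (W x y * W x' y)) : ℝ) : EReal)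

/-- Mutual information of a joint distribution on `X × X`. -/
def mutualInfo {X : Type*} [Fintype X] (P : X × X → ℝ) : ℝ :=
  ∑ p : X × X, P p * Real.log (P p / ((∑ x', P (p.1, x')) * (∑ x, P (x, p.2))))

/-- Weak expurgated exponent `E'_ex(Q, R)`. The expectation of `dB` is taken in the extended
reals, with `0 * ⊤ = 0`. -/
def Eex' {X Y : Type*} [Fintype X] [Fintype Y] (W : X → Y → ℝ) (Q : X → ℝ) (R : ℝ) : EReal :=
  sInf { z | ∃ P ∈ stdSimplex ℝ (X × X), (∀ x, ∑ x', P (x, x') = Q x) ∧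
    mutualInfo P ≤ R ∧
    z = (∑ p : X × X, (P p : EReal) * dB W p.1 p.2) + ((mutualInfo P - R : ℝ) : EReal) }

/-- The primal exponent
`E^primal_{J,ex}(t, 𝒬ₘ) = min_{R ≥ 0} [t e(R/t, P_V) + max_{Q ∈ 𝒬ₘ} E'_ex(Q, R)]`. -/
def EJexPrimal {V X Y : Type*} [Fintype V] [Fintype X] [Fintype Y]
    (PV : V → ℝ) (W : X → Y → ℝ) (t : ℝ) {m : ℕ} (Qs : Fin m → X → ℝ) : EReal :=
  sInf { z | ∃ R : ℝ, 0 ≤ R ∧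
    z = (t : EReal) * srcRel PV (R / t) + ⨆ c, Eex' W (Qs c) R }

open Classical in
/-- Error probability of a joint source-channel code `(f, φ)`. -/
def pErr {V X Y : Type*} [Fintype V] [Fintype Y] (PV : V → ℝ)
    (W : X → Y → ℝ) {k n : ℕ}
    (f : (Fin k → V) → Fin n → X) (φ : (Fin n → Y) → Fin k → V) : ℝ :=
  ∑ v : Fin k → V, prodDist PV v *
    ∑ y ∈ Finset.univ.filter (fun y : Fin n → Y => φ y ≠ v), Wn W (f v) y

/-- A partition of `𝒱^k` into `m` classes (`cls v` is the index of the class of `v`), each a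
union of source type classes, where the class `c` carries a composition `Qc c ∈ 𝒫ₙ(𝒳)`. -/
def IsTypePartition {V X : Type*} (n : ℕ) {k m : ℕ}
    (cls : (Fin k → V) → Fin m) (Qc : Fin m → X → ℝ) : Prop :=
  (∀ v v' : Fin k → V, empDist v = empDist v' → cls v = cls v') ∧
  (∀ c, IsType n (Qc c))

open Classical in
/-- An admissible partition of `𝒱^k`: moreover the type class of the composition of each class
is at least as large as the class. -/
def AdmissiblePartition {V X : Type*} [Fintype V] [Fintype X] (n : ℕ) {k m : ℕ}
    (cls : (Fin k → V) → Fin m) (Qc : Fin m → X → ℝ) : Prop :=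
  IsTypePartition n cls Qc ∧
  (∀ c, (Finset.univ.filter fun v : Fin k → V => cls v = c).card ≤ (typeClass n (Qc c)).card)

end

section Types

open scoped Classical

variable {α : Type*}

theorem card_filter_eq_mul_empDist {k : ℕ} (v : Fin k → α) (a : α) :
    ((Finset.univ.filter fun i => v i = a).card : ℝ) = k * empDist v a := by
  unfold empDist
  rcases Nat.eq_zero_or_pos k with rfl | hk
  · simp
  · field_simp

theorem empDist_nonneg {k : ℕ} (v : Fin k → α) (a : α) : 0 ≤ empDist v a := by
  unfold empDist; positivity

theorem empDist_apply_pos {k : ℕ} (v : Fin k → α) (i : Fin k) : 0 < empDist v (v i) := by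
  have hk : 0 < k := i.pos
  have : 0 < (Finset.univ.filter fun j => v j = v i).card :=
    Finset.card_pos.mpr ⟨i, by simp⟩
  unfold empDist
  positivity

theorem exists_of_empDist_ne_zero {k : ℕ} {v : Fin k → α} {a : α} (h : empDist v a ≠ 0) :
    ∃ i, v i = a := by
  by_contra hne
  push Not at hne
  exact h (by simp [empDist, hne])

/-- Sums along a sequence are averages with respect to its empirical distribution. -/
theorem sum_comp_eq_empDist [Fintype α] {k : ℕ} (v : Fin k → α) (g : α → ℝ) :
    ∑ i, g (v i) = k * ∑ a, empDist v a * g a := by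
  rw [Finset.mul_sum, ← Finset.sum_fiberwise_of_maps_to (s := Finset.univ) (t := Finset.univ)
    (g := v) (fun _ _ => Finset.mem_univ _)]
  refine Finset.sum_congr rfl fun a _ => ?_
  rw [← mul_assoc, ← card_filter_eq_mul_empDist, ← nsmul_eq_mul, ← Finset.sum_const]
  exact Finset.sum_congr rfl fun i hi => by rw [(Finset.mem_filter.mp hi).2]

theorem empDist_mem_stdSimplex [Fintype α] {k : ℕ} (hk : 0 < k) (v : Fin k → α) :
    empDist v ∈ stdSimplex ℝ α := by
  refine ⟨empDist_nonneg v, ?_⟩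
  have h := sum_comp_eq_empDist v (fun _ => 1)
  simp only [mul_one, Finset.sum_const, Finset.card_univ, Fintype.card_fin, nsmul_eq_mul] at h
  have hk' : (k : ℝ) ≠ 0 := by positivity
  field_simp at h
  exact h.symm

theorem prodDist_empDist [Fintype α] {k : ℕ} (v : Fin k → α) :
    prodDist (empDist v) v = Real.exp (-(k * entH (empDist v))) := by
  have h : ∀ i, empDist v (v i) = Real.exp (Real.log (empDist v (v i))) := fun i =>
    (Real.exp_log (empDist_apply_pos v i)).symm
  unfold prodDist
  rw [Finset.prod_congr rfl fun i _ => h i, ← Real.exp_sum,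
    sum_comp_eq_empDist v fun a => Real.log (empDist v a)]
  congr 1
  unfold entH
  ring

/-- The probability of a sequence under a product distribution that charges its type. -/
theorem prodDist_eq_exp [Fintype α] {P : α → ℝ} (hP : ∀ a, 0 ≤ P a) {k : ℕ} (v : Fin k → α)
    (hv : ∀ a, P a = 0 → empDist v a = 0) :
    prodDist P v = Real.exp (-(k * (∑ a, empDist v a * Real.log (empDist v a / P a)
      + entH (empDist v)))) := by
  have hpos : ∀ i, 0 < P (v i) := fun i => lt_of_le_of_ne (hP _) fun h =>
    (empDist_apply_pos v i).ne' (hv _ h.symm)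
  have h : ∀ i, P (v i) = Real.exp (Real.log (P (v i))) := fun i => (Real.exp_log (hpos i)).symm
  unfold prodDist
  rw [Finset.prod_congr rfl fun i _ => h i, ← Real.exp_sum,
    sum_comp_eq_empDist v fun a => Real.log (P a)]
  congr 1
  unfold entH
  rw [← sub_eq_add_neg, ← Finset.sum_sub_distrib, ← mul_neg, ← Finset.sum_neg_distrib]
  congr 1
  refine Finset.sum_congr rfl fun a _ => ?_
  by_cases ha : empDist v a = 0
  · simp [ha]
  · rw [Real.log_div ha (fun h => ha (hv a h))]
    ring

theorem prodDist_eq_zero {P : α → ℝ} {k : ℕ} (v : Fin k → α)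
    (hv : ¬ ∀ a, P a = 0 → empDist v a = 0) : prodDist P v = 0 := by
  push Not at hv
  obtain ⟨a, ha, hva⟩ := hv
  obtain ⟨i, rfl⟩ := exists_of_empDist_ne_zero hva
  exact Finset.prod_eq_zero (Finset.mem_univ i) ha

theorem prodDist_nonneg {P : α → ℝ} (hP : ∀ a, 0 ≤ P a) {k : ℕ} (v : Fin k → α) :
    0 ≤ prodDist P v := Finset.prod_nonneg fun _ _ => hP _

theorem sum_prodDist [Fintype α] (P : α → ℝ) (k : ℕ) :
    ∑ v : Fin k → α, prodDist P v = (∑ a, P a) ^ k :=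
  (Fintype.sum_pow P k).symm

/-- There are at most `(k + 1) ^ |α|` types of length-`k` sequences. -/
theorem card_image_empDist_le (α : Type*) [Fintype α] (k : ℕ) :
    ((Finset.univ : Finset (Fin k → α)).image empDist).card ≤ (k + 1) ^ Fintype.card α := by
  let F : (α → Fin (k + 1)) → α → ℝ := fun c a => (c a : ℝ) / k
  have hsub : (Finset.univ : Finset (Fin k → α)).image empDist ⊆ Finset.univ.image F := by
    intro P hP
    obtain ⟨v, -, rfl⟩ := Finset.mem_image.mp hP
    refine Finset.mem_image.mpr ⟨fun a => ⟨(Finset.univ.filter fun i => v i = a).card, ?_⟩,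
      Finset.mem_univ _, ?_⟩
    · exact Nat.lt_succ_of_le ((Finset.card_le_univ _).trans_eq (Fintype.card_fin k))
    · funext a
      simp [F, empDist]
  refine (Finset.card_le_card hsub).trans (Finset.card_image_le.trans_eq ?_)
  simp

theorem sum_exp_neg_entH_le [Fintype α] {k : ℕ} (hk : 0 < k) :
    ∑ v : Fin k → α, Real.exp (-(k * entH (empDist v))) ≤ ((k : ℝ) + 1) ^ Fintype.card α := by
  calc ∑ v : Fin k → α, Real.exp (-(k * entH (empDist v)))
      = ∑ v : Fin k → α, prodDist (empDist v) v :=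
        Finset.sum_congr rfl fun v _ => (prodDist_empDist v).symm
    _ ≤ ∑ v : Fin k → α, ∑ P ∈ (Finset.univ : Finset (Fin k → α)).image empDist,
          prodDist P v := by
        refine Finset.sum_le_sum fun v _ => ?_
        refine Finset.single_le_sum (f := fun P => prodDist P v) (fun P hP => ?_)
          (Finset.mem_image_of_mem _ (Finset.mem_univ v))
        obtain ⟨u, -, rfl⟩ := Finset.mem_image.mp hP
        exact prodDist_nonneg (empDist_nonneg u) v
    _ = ∑ P ∈ (Finset.univ : Finset (Fin k → α)).image empDist, 1 := by
        rw [Finset.sum_comm]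
        refine Finset.sum_congr rfl fun P hP => ?_
        obtain ⟨u, -, rfl⟩ := Finset.mem_image.mp hP
        rw [sum_prodDist, (empDist_mem_stdSimplex hk u).2, one_pow]
    _ ≤ ((k : ℝ) + 1) ^ Fintype.card α := by
        rw [Finset.sum_const, nsmul_eq_mul, mul_one]
        exact_mod_cast card_image_empDist_le α k

theorem factorial_mul_exp_le (m : ℕ) :
    (m.factorial : ℝ) * Real.exp m ≤ Real.exp 1 * (m + 1) * (m : ℝ) ^ m := by
  have key : ∀ m : ℕ, ((m + 1).factorial : ℝ) * Real.exp ((m + 1 : ℕ) : ℝ)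
      ≤ Real.exp 1 * ((m + 1 : ℕ) : ℝ) * ((m + 1 : ℕ) : ℝ) ^ (m + 1) := by
    intro m
    induction m with
    | zero => simp
    | succ m ih =>
      have hstep : Real.exp 1 * ((m + 1 : ℕ) : ℝ) ^ (m + 2) ≤ ((m + 2 : ℕ) : ℝ) ^ (m + 2) := by
        have h1 : ((m + 1 : ℕ) : ℝ) / ((m + 2 : ℕ) : ℝ) ≤ Real.exp (-(1 / ((m + 2 : ℕ) : ℝ))) := by
          have := Real.one_sub_le_exp_neg (1 / ((m + 2 : ℕ) : ℝ))
          refine le_trans (le_of_eq ?_) this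
          push_cast
          field_simp
          ring
        have h2 := pow_le_pow_left₀ (by positivity) h1 (m + 2)
        rw [← Real.exp_nat_mul, div_pow, div_le_iff₀ (by positivity)] at h2
        have h3 : ((m + 2 : ℕ) : ℝ) * -(1 / ((m + 2 : ℕ) : ℝ)) = -1 := by
          field_simp
        rw [h3, Real.exp_neg] at h2
        calc _ ≤ Real.exp 1 * ((Real.exp 1)⁻¹ * ((m + 2 : ℕ) : ℝ) ^ (m + 2)) := by gcongr
          _ = _ := by rw [← mul_assoc, mul_inv_cancel₀ (Real.exp_pos 1).ne', one_mul]
      calc ((m + 1 + 1).factorial : ℝ) * Real.exp ((m + 1 + 1 : ℕ) : ℝ)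
          = ((m + 2 : ℕ) : ℝ) * Real.exp 1 *
              (((m + 1).factorial : ℝ) * Real.exp ((m + 1 : ℕ) : ℝ)) := by
            rw [Nat.factorial_succ (m + 1), Nat.cast_succ (m + 1), Real.exp_add]
            push_cast
            ring
        _ ≤ ((m + 2 : ℕ) : ℝ) * Real.exp 1 *
              (Real.exp 1 * ((m + 1 : ℕ) : ℝ) * ((m + 1 : ℕ) : ℝ) ^ (m + 1)) := by gcongr
        _ = Real.exp 1 * ((m + 2 : ℕ) : ℝ) * (Real.exp 1 * ((m + 1 : ℕ) : ℝ) ^ (m + 2)) := by ring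
        _ ≤ _ := by gcongr
  cases m with
  | zero => simp
  | succ m =>
    refine (key m).trans ?_
    gcongr
    linarith

/-- A sequence has at least `n! / ∏ cₐ!` rearrangements. -/
theorem factorial_le_card_typeClass_mul [Fintype α] {n : ℕ} (v : Fin n → α) :
    n.factorial ≤ (∏ a, (Finset.univ.filter fun i => v i = a).card.factorial) *
      (typeClass n (empDist v)).card := by
  have himg : ((Finset.univ : Finset (Equiv.Perm (Fin n))).image fun g : Equiv.Perm (Fin n) => v ∘ g) ⊆
      typeClass n (empDist v) := by
    intro u hu
    obtain ⟨g, -, rfl⟩ := Finset.mem_image.mp hu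
    refine Finset.mem_filter.mpr ⟨Finset.mem_univ _, ?_⟩
    funext a
    unfold empDist
    congr 2
    exact Finset.card_equiv g (by simp)
  have h := Finset.card_le_mul_card_image (f := fun g : Equiv.Perm (Fin n) => v ∘ g) Finset.univ
    (∏ a, (Finset.univ.filter fun i => v i = a).card.factorial) ?_
  · rw [Finset.card_univ, Fintype.card_perm, Fintype.card_fin] at h
    exact h.trans (Nat.mul_le_mul_left _ (Finset.card_le_card himg))
  · intro u hu
    obtain ⟨g₀, -, rfl⟩ := Finset.mem_image.mp hu
    have hs := DomMulAct.stabilizer_card v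
    simp only [Fintype.card_subtype] at hs
    rw [← hs]
    refine le_of_eq (Finset.card_equiv (Equiv.mulRight g₀⁻¹) fun g => ?_)
    simp only [Finset.mem_filter, Finset.mem_univ, true_and, Equiv.coe_mulRight]
    constructor
    · intro hg
      funext i
      have := congrFun hg (g₀⁻¹ i)
      simpa using this
    · intro hg
      funext i
      have := congrFun hg (g₀ i)
      simpa using this

/-- A type class has cardinality at least `exp (n H)`, up to a polynomial factor. -/
theorem exp_entH_le_card_typeClass [Fintype α] {n : ℕ} (hn : 0 < n) {Q : α → ℝ}
    (hQ : IsType n Q) :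
    Real.exp (n * entH Q) ≤ (Real.exp 1 * (n + 1)) ^ Fintype.card α * (typeClass n Q).card := by
  obtain ⟨v, rfl⟩ := hQ
  let c : α → ℕ := fun a => (Finset.univ.filter fun i => v i = a).card
  have hsum : ∑ a, c a = n := by
    have := Finset.card_eq_sum_card_fiberwise (f := v) (s := Finset.univ) (t := Finset.univ)
      (fun _ _ => by simp)
    simpa [c] using this.symm
  have hcn : ∀ a, c a ≤ n := fun a => hsum ▸ Finset.single_le_sum (fun _ _ => Nat.zero_le _)
    (Finset.mem_univ a)
  have hprod : prodDist (empDist v) v = (∏ a, (c a : ℝ) ^ c a) / (n : ℝ) ^ n := by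
    have h1 : prodDist (empDist v) v = ∏ i, ((c (v i) : ℝ) / n) := rfl
    rw [h1, Finset.prod_div_distrib, Finset.prod_const, Finset.card_univ, Fintype.card_fin,
      ← Finset.prod_fiberwise_of_maps_to (s := Finset.univ) (t := Finset.univ)
      (g := v) (fun _ _ => Finset.mem_univ _)]
    congr 1
    refine Finset.prod_congr rfl fun a _ => ?_
    rw [← Finset.prod_const]
    exact Finset.prod_congr rfl fun i hi => by rw [(Finset.mem_filter.mp hi).2]
  have hnn : (n : ℝ) ^ n ≤ n.factorial * Real.exp n := by
    have := Real.pow_div_factorial_le_exp (n : ℝ) (by positivity) n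
    rw [div_le_iff₀ (by positivity)] at this
    linarith
  have hfac : (n.factorial : ℝ) ≤ (∏ a, ((c a).factorial : ℝ)) * (typeClass n (empDist v)).card := by
    exact_mod_cast factorial_le_card_typeClass_mul v
  have hexp : Real.exp n = ∏ a, Real.exp (c a) := by
    rw [← Real.exp_sum, ← Nat.cast_sum, hsum]
  have hmain : (n : ℝ) ^ n ≤ (Real.exp 1 * (n + 1)) ^ Fintype.card α *
      (typeClass n (empDist v)).card * ∏ a, (c a : ℝ) ^ c a := by
    calc (n : ℝ) ^ n ≤ n.factorial * Real.exp n := hnn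
      _ ≤ (∏ a, ((c a).factorial : ℝ)) * (typeClass n (empDist v)).card * Real.exp n := by gcongr
      _ = (∏ a, ((c a).factorial : ℝ) * Real.exp (c a)) * (typeClass n (empDist v)).card := by
          rw [hexp, Finset.prod_mul_distrib]; ring
      _ ≤ (∏ a, (Real.exp 1 * (n + 1)) * (c a : ℝ) ^ c a) * (typeClass n (empDist v)).card := by
          refine mul_le_mul_of_nonneg_right (Finset.prod_le_prod (fun a _ => by positivity)
            fun a _ => (factorial_mul_exp_le (c a)).trans ?_) (Nat.cast_nonneg _)
          have : (c a : ℝ) ≤ n := by exact_mod_cast hcn a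
          gcongr
      _ = _ := by
          rw [Finset.prod_mul_distrib, Finset.prod_const, Finset.card_univ]; ring
  have hH : Real.exp (n * entH (empDist v)) = (prodDist (empDist v) v)⁻¹ := by
    rw [prodDist_empDist, ← Real.exp_neg, neg_neg]
  have hpos : 0 < prodDist (empDist v) v := by rw [prodDist_empDist]; positivity
  rw [hH, inv_le_iff_one_le_mul₀ hpos, hprod, ← mul_div_assoc, one_le_div₀ (by positivity)]
  exact hmain

/-- Every distribution is approximated by types of length-`n` sequences. -/
theorem exists_isType_near [Fintype α] {Q : α → ℝ} (hQ : Q ∈ stdSimplex ℝ α) {n : ℕ}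
    (hn : 0 < n) :
    ∃ T : α → ℝ, IsType n T ∧ ∀ a, |T a - Q a| ≤ (Fintype.card α : ℝ) / n := by
  have hne : Nonempty α := by
    by_contra h
    rw [not_nonempty_iff] at h
    simpa using hQ.2
  obtain ⟨a₀⟩ := hne
  have hn' : (0 : ℝ) < n := by positivity
  let q : α → ℕ := fun a => ⌊n * Q a⌋₊
  have hq : ∀ a, (q a : ℝ) ≤ n * Q a := fun a => Nat.floor_le (mul_nonneg hn'.le (hQ.1 a))
  have hq' : ∀ a, n * Q a < q a + 1 := fun a => Nat.lt_floor_add_one _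
  have hsumle : (∑ a, (q a : ℝ)) ≤ n := by
    calc (∑ a, (q a : ℝ)) ≤ ∑ a, n * Q a := Finset.sum_le_sum fun a _ => hq a
      _ = n := by rw [← Finset.mul_sum, hQ.2, mul_one]
  have hsumge : (n : ℝ) ≤ (∑ a, (q a : ℝ)) + Fintype.card α := by
    calc (n : ℝ) = ∑ a, n * Q a := by rw [← Finset.mul_sum, hQ.2, mul_one]
      _ ≤ ∑ a, ((q a : ℝ) + 1) := Finset.sum_le_sum fun a _ => (hq' a).le
      _ = _ := by rw [Finset.sum_add_distrib]; simp
  have hsumle' : ∑ a, q a ≤ n := by exact_mod_cast hsumle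
  let c : α → ℕ := fun a => q a + if a = a₀ then n - ∑ b, q b else 0
  have hc : ∑ a, c a = n := by
    simp only [c, Finset.sum_add_distrib, Finset.sum_ite_eq', Finset.mem_univ, if_true]
    omega
  let e : Fin n ≃ Σ a, Fin (c a) := Fintype.equivOfCardEq (by simp [hc])
  have hcount : ∀ a, (Finset.univ.filter fun i => (e i).1 = a).card = c a := by
    intro a
    rw [Finset.card_equiv (t := Finset.univ.image fun j => (⟨a, j⟩ : Σ a, Fin (c a))) e,
      Finset.card_image_of_injective _ sigma_mk_injective, Finset.card_univ, Fintype.card_fin]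
    intro i
    simp only [Finset.mem_filter, Finset.mem_univ, true_and, Finset.mem_image]
    constructor
    · rintro rfl
      exact ⟨(e i).2, rfl⟩
    · rintro ⟨j, hj⟩
      rw [← hj]
  refine ⟨empDist fun i => (e i).1, ⟨_, rfl⟩, fun a => ?_⟩
  have hval : empDist (fun i => (e i).1) a = (c a : ℝ) / n := by
    rw [← hcount a]; rfl
  have hcard : (1 : ℝ) ≤ Fintype.card α := by
    exact_mod_cast Fintype.card_pos_iff.mpr ⟨a₀⟩
  have hrem : ((n - ∑ b, q b : ℕ) : ℝ) = n - ∑ b, (q b : ℝ) := by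
    rw [Nat.cast_sub hsumle', Nat.cast_sum]
  have hca : |(c a : ℝ) - n * Q a| ≤ Fintype.card α := by
    have h1 := hq a
    have h2 := hq' a
    by_cases ha : a = a₀
    · have : (c a : ℝ) = q a + (n - ∑ b, (q b : ℝ)) := by simp [c, ha, ← hrem]
      rw [this, abs_le]
      constructor <;> linarith
    · have : (c a : ℝ) = q a := by simp [c, ha]
      rw [this, abs_le]
      constructor <;> linarith
  rw [hval, le_div_iff₀ hn', ← abs_of_pos hn', ← abs_mul, abs_of_pos hn', sub_mul,
    div_mul_cancel₀ _ hn'.ne', mul_comm (Q a)]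
  exact hca

end Types

section Information

open scoped Classical

variable {α : Type*} [Fintype α]

/-- Empirical mutual information of two sequences. -/
noncomputable def seqInfo {n : ℕ} (x x' : Fin n → α) : ℝ :=
  entH (empDist x) + entH (empDist x') - entH (empDist fun l => (x l, x' l))

theorem sum_empDist_prod_fst {n : ℕ} (x x' : Fin n → α) (a : α) :
    ∑ b, empDist (fun l => (x l, x' l)) (a, b) = empDist x a := by
  unfold empDist
  rw [← Finset.sum_div, ← Nat.cast_sum]
  congr 2
  rw [Finset.card_eq_sum_card_fiberwise (f := x') (t := Finset.univ) (fun _ _ => by simp)]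
  refine Finset.sum_congr rfl fun b _ => ?_
  rw [Finset.filter_filter]
  simp only [Prod.mk.injEq]

theorem sum_empDist_prod_snd {n : ℕ} (x x' : Fin n → α) (b : α) :
    ∑ a, empDist (fun l => (x l, x' l)) (a, b) = empDist x' b := by
  rw [← sum_empDist_prod_fst x' x b]
  refine Finset.sum_congr rfl fun a _ => ?_
  unfold empDist
  congr 2
  simp only [Prod.mk.injEq, and_comm]

theorem seqInfo_comm {n : ℕ} (x x' : Fin n → α) : seqInfo x x' = seqInfo x' x := by
  have h : entH (empDist fun l => (x l, x' l)) = entH (empDist fun l => (x' l, x l)) := by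
    unfold entH
    congr 1
    refine Fintype.sum_equiv (Equiv.prodComm α α) _ _ fun p => ?_
    have : empDist (fun l => (x l, x' l)) p = empDist (fun l => (x' l, x l)) p.swap := by
      unfold empDist
      congr 2
      simp only [Prod.ext_iff, Prod.fst_swap, Prod.snd_swap, and_comm]
    rw [this]
    rfl
  unfold seqInfo
  rw [h]
  ring

theorem mutualInfo_eq_entH {P : α × α → ℝ} (hP : ∀ p, 0 ≤ P p) :
    mutualInfo P = entH (fun a => ∑ b, P (a, b)) + entH (fun b => ∑ a, P (a, b)) - entH P := by
  have h1 : ∑ a, (∑ b, P (a, b)) * Real.log (∑ b, P (a, b))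
      = ∑ p : α × α, P p * Real.log (∑ b, P (p.1, b)) := by
    rw [Fintype.sum_prod_type]
    exact Finset.sum_congr rfl fun a _ => by rw [Finset.sum_mul]
  have h2 : ∑ b, (∑ a, P (a, b)) * Real.log (∑ a, P (a, b))
      = ∑ p : α × α, P p * Real.log (∑ a, P (a, p.2)) := by
    rw [Fintype.sum_prod_type_right]
    exact Finset.sum_congr rfl fun a _ => by rw [Finset.sum_mul]
  unfold mutualInfo entH
  rw [h1, h2, ← sub_eq_zero]
  simp only [sub_neg_eq_add]
  rw [← neg_add, ← Finset.sum_add_distrib, neg_add_eq_sub, ← Finset.sum_sub_distrib,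
    ← Finset.sum_sub_distrib]
  refine Finset.sum_eq_zero fun p _ => ?_
  rcases (hP p).eq_or_lt with h0 | hpos
  · simp [← h0]
  · have hf : 0 < ∑ b, P (p.1, b) := hpos.trans_le
      (Finset.single_le_sum (f := fun b => P (p.1, b)) (fun b _ => hP _) (Finset.mem_univ p.2))
    have hs : 0 < ∑ a, P (a, p.2) := hpos.trans_le
      (Finset.single_le_sum (f := fun a => P (a, p.2)) (fun b _ => hP _) (Finset.mem_univ p.1))
    rw [Real.log_div hpos.ne' (by positivity), Real.log_mul hf.ne' hs.ne']
    ring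

theorem mutualInfo_empDist {n : ℕ} (x x' : Fin n → α) :
    mutualInfo (empDist fun l => (x l, x' l)) = seqInfo x x' := by
  rw [mutualInfo_eq_entH (empDist_nonneg _)]
  simp only [sum_empDist_prod_fst, sum_empDist_prod_snd]
  rfl

/-- The average of `exp (n I(x; x'))` over a type class is polynomial in `n`. -/
theorem sum_exp_seqInfo_le {n : ℕ} (hn : 0 < n) {Q : α → ℝ} (hQ : IsType n Q) (x : Fin n → α) :
    ∑ x' ∈ typeClass n Q, Real.exp (n * seqInfo x' x) ≤
      ((n : ℝ) + 1) ^ Fintype.card (α × α) * (Real.exp 1 * (n + 1)) ^ Fintype.card α *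
        (typeClass n Q).card := by
  let J : Finset (α × α → ℝ) := (Finset.univ : Finset (Fin n → α × α)).image empDist
  let F : (α × α → ℝ) → (Fin n → α) → ℝ := fun P x' => ∏ l, P (x l, x' l) / empDist x (x l)
  have hFnn : ∀ P ∈ J, ∀ x', 0 ≤ F P x' := by
    intro P hP x'
    obtain ⟨u, -, rfl⟩ := Finset.mem_image.mp hP
    exact Finset.prod_nonneg fun l _ => div_nonneg (empDist_nonneg _ _) (empDist_nonneg _ _)
  let J' : Finset (α × α → ℝ) := J.filter fun P => ∀ a, ∑ b, P (a, b) = empDist x a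
  have hmem : ∀ x' : Fin n → α, (empDist fun l => (x l, x' l)) ∈ J' := fun x' =>
    Finset.mem_filter.mpr ⟨Finset.mem_image_of_mem _ (Finset.mem_univ _),
      sum_empDist_prod_fst x x'⟩
  have hF : ∀ x' : Fin n → α, F (empDist fun l => (x l, x' l)) x' =
      Real.exp (n * (entH (empDist x) - entH (empDist fun l => (x l, x' l)))) := by
    intro x'
    have h1 := prodDist_empDist fun l => (x l, x' l)
    have h2 := prodDist_empDist x
    unfold prodDist at h1 h2
    simp only [F]
    rw [Finset.prod_div_distrib, h1, h2, ← Real.exp_sub]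
    congr 1
    ring
  have hone : ∀ P ∈ J', ∑ x', F P x' = 1 := by
    intro P hP
    have hP' := (Finset.mem_filter.mp hP).2
    have := Finset.prod_univ_sum (fun _ : Fin n => (Finset.univ : Finset α))
      (fun l b => P (x l, b) / empDist x (x l))
    rw [Fintype.piFinset_univ] at this
    rw [← this]
    refine Finset.prod_eq_one fun l _ => ?_
    rw [← Finset.sum_div, hP', div_self (empDist_apply_pos x l).ne']
  have hcond : ∑ x' : Fin n → α, F (empDist fun l => (x l, x' l)) x' ≤
      ((n : ℝ) + 1) ^ Fintype.card (α × α) := by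
    calc _ ≤ ∑ x' : Fin n → α, ∑ P ∈ J', F P x' :=
          Finset.sum_le_sum fun x' _ => Finset.single_le_sum (f := fun P => F P x')
            (fun P hP => hFnn P (Finset.mem_filter.mp hP).1 x') (hmem x')
      _ = ∑ P ∈ J', (1 : ℝ) := by rw [Finset.sum_comm]; exact Finset.sum_congr rfl hone
      _ ≤ _ := by
          rw [Finset.sum_const, nsmul_eq_mul, mul_one]
          exact_mod_cast (Finset.card_filter_le _ _).trans (card_image_empDist_le (α × α) n)
  calc ∑ x' ∈ typeClass n Q, Real.exp (n * seqInfo x' x)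
      = ∑ x' ∈ typeClass n Q, Real.exp (n * entH Q) * F (empDist fun l => (x l, x' l)) x' := by
        refine Finset.sum_congr rfl fun x' hx' => ?_
        have hx'Q : empDist x' = Q := (Finset.mem_filter.mp hx').2
        rw [hF, ← Real.exp_add, seqInfo_comm]
        unfold seqInfo
        rw [hx'Q]
        congr 1
        ring
    _ ≤ ∑ x' : Fin n → α, Real.exp (n * entH Q) * F (empDist fun l => (x l, x' l)) x' :=
        Finset.sum_le_sum_of_subset_of_nonneg (Finset.subset_univ _) fun x' _ _ =>
          mul_nonneg (Real.exp_pos _).le (hFnn _ (Finset.mem_filter.mp (hmem x')).1 x')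
    _ ≤ Real.exp (n * entH Q) * ((n : ℝ) + 1) ^ Fintype.card (α × α) := by
        rw [← Finset.mul_sum]
        gcongr
    _ ≤ ((Real.exp 1 * (n + 1)) ^ Fintype.card α * (typeClass n Q).card) *
          ((n : ℝ) + 1) ^ Fintype.card (α × α) := by
        gcongr
        exact exp_entH_le_card_typeClass hn hQ
    _ = _ := by ring

/-- A minimizer of the pairwise potential `∑ w i w j g (f i) (f j)` does at every index at least
as well as the average choice. -/
theorem exists_forall_sum_le_of_average_le {ι β : Type*} [Fintype ι] [DecidableEq ι] (S : ι → Finset β)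
    (hS : ∀ i, (S i).Nonempty) (w : ι → ℝ) (hw : ∀ i, 0 < w i) (g : β → β → ℝ)
    (hg : ∀ x y, g x y = g y x) (B : ℝ) (hB : 0 ≤ B)
    (havg : ∀ i y, ∑ x ∈ S i, g x y ≤ B * (S i).card) :
    ∃ f : ι → β, (∀ i, f i ∈ S i) ∧
      ∀ i, ∑ j ∈ Finset.univ.erase i, w j * g (f i) (f j) ≤ B * ∑ j, w j := by
  let F : (ι → β) → ι → ι → ℝ := fun f a b => if a = b then 0 else w a * w b * g (f a) (f b)
  let Ψ : (ι → β) → ℝ := fun f => ∑ a, ∑ b, F f a b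
  have hFsymm : ∀ f a b, F f a b = F f b a := by
    intro f a b
    by_cases h : a = b
    · simp [F, h]
    · simp only [F, h, Ne.symm h, if_false, hg (f a) (f b)]; ring
  have hsplit : ∀ f i, Ψ f = 2 * (w i * ∑ j ∈ Finset.univ.erase i, w j * g (f i) (f j)) +
      ∑ a ∈ Finset.univ.erase i, ∑ b ∈ Finset.univ.erase i, F f a b := by
    intro f i
    have hrow : ∑ b ∈ Finset.univ.erase i, F f i b =
        w i * ∑ j ∈ Finset.univ.erase i, w j * g (f i) (f j) := by
      rw [Finset.mul_sum]
      refine Finset.sum_congr rfl fun j hj => ?_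
      simp only [F, Ne.symm (Finset.ne_of_mem_erase hj), if_false]
      ring
    have hdiag : F f i i = 0 := by simp [F]
    simp only [Ψ]
    rw [← Finset.add_sum_erase _ _ (Finset.mem_univ i),
      ← Finset.add_sum_erase _ _ (Finset.mem_univ i), hdiag, zero_add]
    have : ∑ a ∈ Finset.univ.erase i, ∑ b, F f a b = ∑ b ∈ Finset.univ.erase i, F f i b +
        ∑ a ∈ Finset.univ.erase i, ∑ b ∈ Finset.univ.erase i, F f a b := by
      rw [← Finset.sum_add_distrib]
      refine Finset.sum_congr rfl fun a _ => ?_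
      rw [← Finset.add_sum_erase _ _ (Finset.mem_univ i), hFsymm f a i]
    rw [this, hrow]
    ring
  obtain ⟨f, hfS, hmin⟩ := Finset.exists_min_image (Fintype.piFinset S) Ψ
    (Fintype.piFinset_nonempty.mpr hS)
  rw [Fintype.mem_piFinset] at hfS
  refine ⟨f, hfS, fun i => ?_⟩
  have hle : ∀ x ∈ S i, ∑ j ∈ Finset.univ.erase i, w j * g (f i) (f j) ≤
      ∑ j ∈ Finset.univ.erase i, w j * g x (f j) := by
    intro x hx
    have h := hmin (Function.update f i x) (by
      rw [Fintype.mem_piFinset]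
      intro j
      by_cases hj : j = i
      · subst hj; simpa using hx
      · simpa [hj] using hfS j)
    have hrest : ∑ a ∈ Finset.univ.erase i, ∑ b ∈ Finset.univ.erase i,
          F (Function.update f i x) a b =
        ∑ a ∈ Finset.univ.erase i, ∑ b ∈ Finset.univ.erase i, F f a b := by
      refine Finset.sum_congr rfl fun a ha => Finset.sum_congr rfl fun b hb => ?_
      simp only [F, Function.update_of_ne (Finset.ne_of_mem_erase ha),
        Function.update_of_ne (Finset.ne_of_mem_erase hb)]
    have hrow : ∑ j ∈ Finset.univ.erase i,
          w j * g (Function.update f i x i) (Function.update f i x j) =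
        ∑ j ∈ Finset.univ.erase i, w j * g x (f j) := by
      refine Finset.sum_congr rfl fun j hj => ?_
      rw [Function.update_self, Function.update_of_ne (Finset.ne_of_mem_erase hj)]
    rw [hsplit f i, hsplit (Function.update f i x) i, hrest, hrow] at h
    exact le_of_mul_le_mul_left (by linarith) (hw i)
  have hcard : (0 : ℝ) < (S i).card := by exact_mod_cast Finset.card_pos.mpr (hS i)
  refine le_of_mul_le_mul_left ?_ hcard
  calc ((S i).card : ℝ) * ∑ j ∈ Finset.univ.erase i, w j * g (f i) (f j)
      = ∑ _x ∈ S i, ∑ j ∈ Finset.univ.erase i, w j * g (f i) (f j) := by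
        rw [Finset.sum_const, nsmul_eq_mul]
    _ ≤ ∑ x ∈ S i, ∑ j ∈ Finset.univ.erase i, w j * g x (f j) := Finset.sum_le_sum hle
    _ = ∑ j ∈ Finset.univ.erase i, w j * ∑ x ∈ S i, g x (f j) := by
        rw [Finset.sum_comm]
        exact Finset.sum_congr rfl fun j _ => by rw [Finset.mul_sum]
    _ ≤ ∑ j ∈ Finset.univ.erase i, w j * (B * (S i).card) :=
        Finset.sum_le_sum fun j _ => mul_le_mul_of_nonneg_left (havg i (f j)) (hw j).le
    _ ≤ ∑ j, w j * (B * (S i).card) :=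
        Finset.sum_le_sum_of_subset_of_nonneg (Finset.subset_univ _) fun j _ _ =>
          mul_nonneg (hw j).le (by positivity)
    _ = _ := by rw [← Finset.sum_mul]; ring

end Information

section Exponent

open scoped Classical
open Filter Topology

theorem entH_nonneg {α : Type*} [Fintype α] {P : α → ℝ} (hP : P ∈ stdSimplex ℝ α) :
    0 ≤ entH P := by
  unfold entH
  rw [← Finset.sum_neg_distrib]
  refine Finset.sum_nonneg fun a _ => ?_
  have h1 : P a ≤ 1 := hP.2 ▸ Finset.single_le_sum (fun b _ => hP.1 b) (Finset.mem_univ a)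
  have := Real.negMulLog_nonneg (hP.1 a) h1
  rwa [Real.negMulLog, neg_mul] at this

theorem continuous_entH {α : Type*} [Fintype α] : Continuous (entH : (α → ℝ) → ℝ) := by
  unfold entH
  exact (continuous_finsetSum _ fun a _ =>
    Real.continuous_mul_log.comp (continuous_apply a)).neg

theorem entH_le_card {α : Type*} [Fintype α] {P : α → ℝ} (hP : P ∈ stdSimplex ℝ α) :
    entH P ≤ Fintype.card α := by
  unfold entH
  rw [← Finset.sum_neg_distrib]
  calc ∑ a, -(P a * Real.log (P a)) ≤ ∑ _a : α, (1 : ℝ) := by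
        refine Finset.sum_le_sum fun a _ => ?_
        rcases (hP.1 a).eq_or_lt with h | h
        · simp [← h]
        · have := Real.one_sub_inv_le_log_of_pos h
          have h2 := mul_le_mul_of_nonneg_left this h.le
          rw [mul_sub, mul_inv_cancel₀ h.ne'] at h2
          linarith
    _ = Fintype.card α := by simp

theorem sum_mul_log_div_nonneg {α : Type*} [Fintype α] {Q P : α → ℝ} (hQ : ∀ a, 0 ≤ Q a)
    (hP : ∀ a, 0 ≤ P a) (hQP : ∀ a, P a = 0 → Q a = 0) (hsum : ∑ a, P a ≤ ∑ a, Q a) :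
    0 ≤ ∑ a, Q a * Real.log (Q a / P a) := by
  have h : ∑ a, (Q a - P a) ≤ ∑ a, Q a * Real.log (Q a / P a) := by
    refine Finset.sum_le_sum fun a _ => ?_
    rcases (hQ a).eq_or_lt with h0 | hpos
    · simp [← h0, hP a]
    · have hPpos : 0 < P a := lt_of_le_of_ne (hP a) fun h => hpos.ne' (hQP a h.symm)
      have := mul_le_mul_of_nonneg_left
        (Real.one_sub_inv_le_log_of_pos (div_pos hpos hPpos)) hpos.le
      refine le_trans (le_of_eq ?_) this
      field_simp
  rw [Finset.sum_sub_distrib] at h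
  linarith

theorem continuous_sum_mul_log_div {α : Type*} [Fintype α] (P : α → ℝ) :
    Continuous fun Q : α → ℝ => ∑ a, Q a * Real.log (Q a / P a) := by
  refine continuous_finsetSum _ fun a _ => ?_
  by_cases hP : P a = 0
  · simp only [hP, div_zero, Real.log_zero, mul_zero]
    exact continuous_const
  · have : (fun Q : α → ℝ => Q a * Real.log (Q a / P a)) =
        fun Q => P a * ((Q a / P a) * Real.log (Q a / P a)) := by
      funext Q
      field_simp
    rw [this]
    have hdiv : Continuous fun Q : α → ℝ => Q a / P a := by fun_prop
    exact continuous_const.mul (Real.continuous_mul_log.comp hdiv)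

theorem mutualInfo_nonneg {X : Type*} [Fintype X] {P : X × X → ℝ}
    (hP : P ∈ stdSimplex ℝ (X × X)) : 0 ≤ mutualInfo P := by
  unfold mutualInfo
  refine sum_mul_log_div_nonneg (P := fun p : X × X => (∑ x', P (p.1, x')) * ∑ x, P (x, p.2))
    hP.1 (fun p => mul_nonneg (Finset.sum_nonneg fun _ _ => hP.1 _)
      (Finset.sum_nonneg fun _ _ => hP.1 _)) (fun p hp => ?_) ?_
  · rcases mul_eq_zero.mp hp with h | h
    · exact (Finset.sum_eq_zero_iff_of_nonneg fun x' _ => hP.1 (p.1, x')).mp h p.2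
        (Finset.mem_univ _)
    · exact (Finset.sum_eq_zero_iff_of_nonneg fun x _ => hP.1 (x, p.2)).mp h p.1
        (Finset.mem_univ _)
  · rw [hP.2, Fintype.sum_prod_type]
    simp only
    rw [← Finset.sum_mul_sum, ← Fintype.sum_prod_type (f := P),
      ← Fintype.sum_prod_type_right (f := P), hP.2, one_mul]

/-- Bhattacharyya coefficient of two channel inputs. -/
noncomputable def bhattCoeff {X Y : Type*} [Fintype Y] (W : X → Y → ℝ) (x x' : X) : ℝ :=
  ∑ y, Real.sqrt (W x y * W x' y)

theorem bhattCoeff_nonneg {X Y : Type*} [Fintype Y] (W : X → Y → ℝ) (x x' : X) :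
    0 ≤ bhattCoeff W x x' := Finset.sum_nonneg fun _ _ => Real.sqrt_nonneg _

theorem bhattCoeff_le_one {X Y : Type*} [Fintype Y] {W : X → Y → ℝ} (hW : IsDMC W) (x x' : X) :
    bhattCoeff W x x' ≤ 1 := by
  calc bhattCoeff W x x' ≤ ∑ y, (W x y + W x' y) / 2 := by
        refine Finset.sum_le_sum fun y _ => Real.sqrt_le_iff.mpr ⟨?_, ?_⟩
        · linarith [(hW x).1 y, (hW x').1 y]
        · nlinarith [sq_nonneg (W x y - W x' y)]
    _ = 1 := by
        rw [← Finset.sum_div, Finset.sum_add_distrib, (hW x).2, (hW x').2]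
        norm_num

theorem bhattCoeff_self {X Y : Type*} [Fintype Y] {W : X → Y → ℝ} (hW : IsDMC W) (x : X) :
    bhattCoeff W x x = 1 := by
  rw [← (hW x).2]
  exact Finset.sum_congr rfl fun y _ => Real.sqrt_mul_self ((hW x).1 y)

theorem bhattCoeff_comm {X Y : Type*} [Fintype Y] (W : X → Y → ℝ) (x x' : X) :
    bhattCoeff W x x' = bhattCoeff W x' x :=
  Finset.sum_congr rfl fun y _ => by rw [mul_comm]

/-- For every pair of source type and rate compatible with it, one of the compositions near
`Qs` has joint types all of which satisfy the real form of the primal bound with exponent `E`. -/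
def PrimalBoundNear {V X Y : Type*} [Fintype V] [Fintype X] [Fintype Y] (PV : V → ℝ)
    (W : X → Y → ℝ) (t : ℝ) {m : ℕ} (Qs : Fin m → X → ℝ) (E δ : ℝ) : Prop :=
  ∀ (s R : ℝ) (Q : V → ℝ) (Q' : Fin m → X → ℝ), |s - t| ≤ δ → Q ∈ stdSimplex ℝ V →
    (∀ a, PV a = 0 → Q a = 0) → |R - s * entH Q| ≤ δ → (∀ c x, |Q' c x - Qs c x| ≤ δ) →
    ∃ c, ∀ P ∈ stdSimplex ℝ (X × X), (∀ x, ∑ x', P (x, x') = Q' c x) → mutualInfo P ≤ R →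
      (∀ p : X × X, bhattCoeff W p.1 p.2 = 0 → P p = 0) →
      E ≤ s * ∑ a, Q a * Real.log (Q a / PV a) +
        (∑ p : X × X, P p * -Real.log (bhattCoeff W p.1 p.2)) + mutualInfo P - R

theorem coe_sum_ereal {ι : Type*} (s : Finset ι) (f : ι → ℝ) :
    ((∑ i ∈ s, f i : ℝ) : EReal) = ∑ i ∈ s, (f i : EReal) :=
  map_sum (⟨⟨Real.toEReal, rfl⟩, EReal.coe_add⟩ : ℝ →+ EReal) f s

theorem EJexPrimal_le {V X Y : Type*} [Fintype V] [Fintype X] [Fintype Y] {PV : V → ℝ}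
    {W : X → Y → ℝ} {t : ℝ} (ht : 0 < t) {m : ℕ} {Qs : Fin m → X → ℝ} {Q : V → ℝ}
    (hQ : Q ∈ stdSimplex ℝ V) (hQP : ∀ a, PV a = 0 → Q a = 0) {P : Fin m → X × X → ℝ}
    (hP : ∀ c, P c ∈ stdSimplex ℝ (X × X)) (hmarg : ∀ c x, ∑ x', P c (x, x') = Qs c x)
    (hI : ∀ c, mutualInfo (P c) ≤ t * entH Q)
    (hsupp : ∀ c, ∀ p : X × X, bhattCoeff W p.1 p.2 = 0 → P c p = 0) {E : ℝ}
    (hE : ∀ c, t * ∑ a, Q a * Real.log (Q a / PV a) +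
        (∑ p : X × X, P c p * -Real.log (bhattCoeff W p.1 p.2)) + mutualInfo (P c)
          - t * entH Q ≤ E) :
    EJexPrimal PV W t Qs ≤ (E : EReal) := by
  set D := ∑ a, Q a * Real.log (Q a / PV a) with hD
  have h1 : srcRel PV (t * entH Q / t) ≤ (D : EReal) := by
    refine sInf_le ⟨Q, hQ, le_of_eq (mul_div_cancel_left₀ _ ht.ne'), ?_⟩
    rw [KL, if_pos hQP]
  have h2 : ∀ c, Eex' W (Qs c) (t * entH Q) ≤ ((E - t * D : ℝ) : EReal) := by
    intro c
    refine le_trans (sInf_le ⟨P c, hP c, hmarg c, hI c, rfl⟩) ?_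
    have hs : (∑ p : X × X, (P c p : EReal) * dB W p.1 p.2) =
        ((∑ p : X × X, P c p * -Real.log (bhattCoeff W p.1 p.2) : ℝ) : EReal) := by
      rw [coe_sum_ereal]
      refine Finset.sum_congr rfl fun p _ => ?_
      by_cases hb : bhattCoeff W p.1 p.2 = 0
      · simp [hsupp c p hb]
      · rw [EReal.coe_mul, dB]
        unfold bhattCoeff at hb ⊢
        rw [if_neg hb]
    rw [hs, ← EReal.coe_add, EReal.coe_le_coe_iff]
    linarith [hE c]
  refine le_trans (sInf_le ⟨t * entH Q, mul_nonneg ht.le (entH_nonneg hQ), rfl⟩) ?_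
  calc (t : EReal) * srcRel PV (t * entH Q / t) + ⨆ c, Eex' W (Qs c) (t * entH Q)
      ≤ (t : EReal) * (D : EReal) + ((E - t * D : ℝ) : EReal) :=
        add_le_add (mul_le_mul_of_nonneg_left h1 (by exact_mod_cast ht.le)) (iSup_le h2)
    _ = (E : EReal) := by
        rw [← EReal.coe_mul, ← EReal.coe_add]
        congr 1
        ring

theorem exists_primalBoundNear {V X Y : Type*} [Fintype V] [Fintype X] [Fintype Y] {PV : V → ℝ}
    {W : X → Y → ℝ} {t : ℝ} (ht : 0 < t) {m : ℕ} {Qs : Fin m → X → ℝ} {E₀ : ℝ}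
    (hE₀ : (E₀ : EReal) ≤ EJexPrimal PV W t Qs) {η : ℝ} (hη : 0 < η) :
    ∃ δ > 0, PrimalBoundNear PV W t Qs (E₀ - η) δ := by
  by_contra hcon
  push Not at hcon
  have hcon' := fun l : ℕ => hcon (1 / ((l : ℝ) + 1)) (by positivity)
  unfold PrimalBoundNear at hcon'
  push Not at hcon'
  choose s R Q Q' hs hQ hac hR hQ' P hP hmarg hI hsupp hlt using hcon'
  have hδ : Tendsto (fun l : ℕ => 1 / ((l : ℝ) + 1)) atTop (𝓝 0) :=
    tendsto_one_div_add_atTop_nhds_zero_nat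
  have hcomp : IsCompact (stdSimplex ℝ V ×ˢ
      Set.pi Set.univ fun _ : Fin m => stdSimplex ℝ (X × X)) :=
    (isCompact_stdSimplex ℝ V).prod (isCompact_univ_pi fun _ => isCompact_stdSimplex ℝ (X × X))
  obtain ⟨⟨q, p⟩, ⟨hq, hp⟩, φ, hφ, hlim⟩ := hcomp.tendsto_subseq
    (x := fun l => (Q l, P l)) fun l => ⟨hQ l, fun c _ => hP l c⟩
  have hqlim : Tendsto (fun l => Q (φ l)) atTop (𝓝 q) := (continuous_fst.tendsto _).comp hlim
  have hplim : ∀ c, Tendsto (fun l => P (φ l) c) atTop (𝓝 (p c)) := fun c =>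
    (((continuous_apply c).comp continuous_snd).tendsto _).comp hlim
  have hpc : ∀ c, p c ∈ stdSimplex ℝ (X × X) := fun c => hp c (Set.mem_univ _)
  have hδ' : Tendsto (fun l : ℕ => 1 / ((φ l : ℝ) + 1)) atTop (𝓝 0) :=
    hδ.comp hφ.tendsto_atTop
  have near : ∀ {u v : ℕ → ℝ} {a : ℝ}, (∀ l, |u l - v l| ≤ 1 / ((φ l : ℝ) + 1)) →
      Tendsto v atTop (𝓝 a) → Tendsto u atTop (𝓝 a) := by
    intro u v a huv hv
    have h0 : Tendsto (fun l => u l - v l) atTop (𝓝 0) := squeeze_zero_norm huv hδ'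
    simpa using h0.add hv
  have hslim : Tendsto (fun l => s (φ l)) atTop (𝓝 t) :=
    near (fun l => hs (φ l)) tendsto_const_nhds
  have hRlim : Tendsto (fun l => R (φ l)) atTop (𝓝 (t * entH q)) :=
    near (fun l => hR (φ l)) (hslim.mul ((continuous_entH.tendsto q).comp hqlim))
  have hIlim : ∀ c, Tendsto (fun l => mutualInfo (P (φ l) c)) atTop (𝓝 (mutualInfo (p c))) := by
    intro c
    rw [mutualInfo_eq_entH (hpc c).1]
    simp only [fun l => mutualInfo_eq_entH (hP (φ l) c).1]
    have hcont : Continuous fun P : X × X → ℝ => entH (fun a => ∑ b, P (a, b)) +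
        entH (fun b => ∑ a, P (a, b)) - entH P := by
      refine ((continuous_entH.comp ?_).add (continuous_entH.comp ?_)).sub continuous_entH <;>
        fun_prop
    exact (hcont.tendsto (p c)).comp (hplim c)
  have hcoord : ∀ c z, Tendsto (fun l => P (φ l) c z) atTop (𝓝 (p c z)) := fun c z =>
    ((continuous_apply z).tendsto _).comp (hplim c)
  have hle : EJexPrimal PV W t Qs ≤ ((E₀ - η : ℝ) : EReal) := by
    refine EJexPrimal_le ht hq (fun a ha => ?_) hpc (fun c x => ?_) (fun c => ?_)
      (fun c z hz => ?_) fun c => ?_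
    · exact tendsto_nhds_unique (((continuous_apply a).tendsto _).comp hqlim)
        (tendsto_const_nhds.congr fun l => (hac (φ l) a ha).symm)
    · refine tendsto_nhds_unique (f := fun l => Q' (φ l) c x) ?_
        (near (fun l => hQ' (φ l) c x) tendsto_const_nhds)
      simp only [← hmarg]
      exact tendsto_finsetSum _ fun x' _ => hcoord c (x, x')
    · exact le_of_tendsto_of_tendsto' (hIlim c) hRlim fun l => hI (φ l) c
    · exact tendsto_nhds_unique (hcoord c z)
        (tendsto_const_nhds.congr fun l => (hsupp (φ l) c z hz).symm)
    · refine le_of_tendsto' (x := atTop) (f := fun l => s (φ l) * ∑ a, Q (φ l) a * Real.log (Q (φ l) a / PV a) +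
        (∑ z : X × X, P (φ l) c z * -Real.log (bhattCoeff W z.1 z.2)) + mutualInfo (P (φ l) c)
          - R (φ l)) ?_ fun l => (hlt (φ l) c).le
      refine (((hslim.mul (((continuous_sum_mul_log_div PV).tendsto q).comp hqlim)).add
        (tendsto_finsetSum _ fun z _ => (hcoord c z).mul_const _)).add (hIlim c)).sub hRlim
  have := hE₀.trans hle
  rw [EReal.coe_le_coe_iff] at this
  linarith

/-- A trivial bound that holds whatever the value of the primal exponent. -/
theorem exists_primalBoundNear_of_pos {V X Y : Type*} [Fintype V] [Fintype X] [Fintype Y]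
    {PV : V → ℝ} (hPV : PV ∈ stdSimplex ℝ V) {W : X → Y → ℝ} (hW : IsDMC W) {t : ℝ} (ht : 0 < t)
    {m : ℕ} (hm : 0 < m) (Qs : Fin m → X → ℝ) :
    ∃ E : ℝ, ∃ δ > 0, PrimalBoundNear PV W t Qs E δ := by
  refine ⟨-((2 * t) * Fintype.card V + t), t, ht, ?_⟩
  intro s R Q Q' hs hQ hac hR _
  refine ⟨⟨0, hm⟩, fun P hP _ _ _ => ?_⟩
  have hs' := abs_le.mp hs
  have hR' := abs_le.mp hR
  have hD : 0 ≤ ∑ a, Q a * Real.log (Q a / PV a) :=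
    sum_mul_log_div_nonneg hQ.1 hPV.1 hac (by rw [hQ.2, hPV.2])
  have hI := mutualInfo_nonneg hP
  have hd : 0 ≤ ∑ p : X × X, P p * -Real.log (bhattCoeff W p.1 p.2) :=
    Finset.sum_nonneg fun p _ => mul_nonneg (hP.1 p) (neg_nonneg.mpr
      (Real.log_nonpos (bhattCoeff_nonneg W _ _) (bhattCoeff_le_one hW _ _)))
  have hs0 : 0 ≤ s := by linarith
  have hsD := mul_nonneg hs0 hD
  have hsH : s * entH Q ≤ (2 * t) * Fintype.card V :=
    mul_le_mul (by linarith) (entH_le_card hQ) (entH_nonneg hQ) (by linarith)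
  linarith

end Exponent

section Coding

open scoped Classical

variable {V X Y : Type*} [Fintype V] [Fintype Y]

theorem Wn_nonneg {W : X → Y → ℝ} (hW : IsDMC W) {n : ℕ} (x : Fin n → X) (y : Fin n → Y) :
    0 ≤ Wn W x y := Finset.prod_nonneg fun _ _ => (hW _).1 _

theorem sum_Wn {W : X → Y → ℝ} (hW : IsDMC W) {n : ℕ} (x : Fin n → X) :
    ∑ y, Wn W x y = 1 := by
  have := Finset.prod_univ_sum (fun _ : Fin n => (Finset.univ : Finset Y))
    (fun l b => W (x l) b)
  rw [Fintype.piFinset_univ] at this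
  unfold Wn
  rw [← this]
  exact Finset.prod_eq_one fun l _ => (hW _).2

theorem sum_sqrt_Wn {W : X → Y → ℝ} (hW : IsDMC W) {n : ℕ} (x x' : Fin n → X) :
    ∑ y, Real.sqrt (Wn W x y * Wn W x' y) = ∏ l, bhattCoeff W (x l) (x' l) := by
  unfold bhattCoeff
  rw [Finset.prod_univ_sum, Fintype.piFinset_univ]
  refine Finset.sum_congr rfl fun y _ => ?_
  unfold Wn
  rw [← Finset.prod_mul_distrib, Real.sqrt_prod _ fun l _ =>
    mul_nonneg ((hW _).1 _) ((hW _).1 _)]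

/-- Union bound with Bhattacharyya coefficients for the maximum a posteriori decoder that only
decodes to messages in `G`. -/
theorem exists_decoder_pErr_le {PV : V → ℝ} (hPV : PV ∈ stdSimplex ℝ V) {W : X → Y → ℝ}
    (hW : IsDMC W) {k n : ℕ} (f : (Fin k → V) → Fin n → X) (G : Finset (Fin k → V)) :
    ∃ φ : (Fin n → Y) → Fin k → V, pErr PV W f φ ≤ ∑ v ∈ Gᶜ, prodDist PV v +
      ∑ v ∈ G, ∑ v' ∈ G.erase v, Real.sqrt (prodDist PV v * prodDist PV v') *
        ∏ l, bhattCoeff W (f v l) (f v' l) := by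
  have hV : Nonempty V := by
    by_contra h
    rw [not_nonempty_iff] at h
    simpa using hPV.2
  have hdec : ∀ y : Fin n → Y, ∃ u : Fin k → V, ∀ v ∈ G, u ∈ G ∧
      prodDist PV v * Wn W (f v) y ≤ prodDist PV u * Wn W (f u) y := by
    intro y
    rcases G.eq_empty_or_nonempty with rfl | hG
    · exact ⟨fun _ => hV.some, by simp⟩
    · obtain ⟨u, hu, hmax⟩ := Finset.exists_max_image G (fun v => prodDist PV v * Wn W (f v) y) hG
      exact ⟨u, fun v hv => ⟨hu, hmax v hv⟩⟩
  choose φ hφ using hdec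
  have hP := fun v : Fin k → V => prodDist_nonneg hPV.1 v
  refine ⟨φ, ?_⟩
  unfold pErr
  rw [← Finset.sum_compl_add_sum G]
  refine add_le_add (Finset.sum_le_sum fun v _ => ?_) (Finset.sum_le_sum fun v hv => ?_)
  · refine mul_le_of_le_one_right (hP v) ?_
    rw [← sum_Wn hW (f v)]
    exact Finset.sum_le_sum_of_subset_of_nonneg (Finset.subset_univ _)
      fun y _ _ => Wn_nonneg hW _ _
  · calc prodDist PV v * ∑ y ∈ Finset.univ.filter (fun y => φ y ≠ v), Wn W (f v) y
        = ∑ y ∈ Finset.univ.filter (fun y => φ y ≠ v), prodDist PV v * Wn W (f v) y := by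
          rw [Finset.mul_sum]
      _ ≤ ∑ y ∈ Finset.univ.filter (fun y => φ y ≠ v), ∑ v' ∈ G.erase v,
            Real.sqrt (prodDist PV v * prodDist PV v') *
              Real.sqrt (Wn W (f v) y * Wn W (f v') y) := by
          refine Finset.sum_le_sum fun y hy => ?_
          have hne : φ y ≠ v := (Finset.mem_filter.mp hy).2
          obtain ⟨hmem, hle⟩ := hφ y v hv
          refine le_trans ?_ (Finset.single_le_sum
            (f := fun v' => Real.sqrt (prodDist PV v * prodDist PV v') *
              Real.sqrt (Wn W (f v) y * Wn W (f v') y)) (fun v' _ => by positivity)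
            (Finset.mem_erase.mpr ⟨hne, hmem⟩))
          have h0 := mul_nonneg (hP v) (Wn_nonneg hW (f v) y)
          rw [← Real.sqrt_mul (mul_nonneg (hP v) (hP _))]
          refine Real.le_sqrt_of_sq_le ?_
          calc (prodDist PV v * Wn W (f v) y) ^ 2
              = (prodDist PV v * Wn W (f v) y) * (prodDist PV v * Wn W (f v) y) := sq _
            _ ≤ (prodDist PV v * Wn W (f v) y) * (prodDist PV (φ y) * Wn W (f (φ y)) y) :=
                mul_le_mul_of_nonneg_left hle h0
            _ = _ := by ring
      _ ≤ ∑ y, ∑ v' ∈ G.erase v, Real.sqrt (prodDist PV v * prodDist PV v') *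
              Real.sqrt (Wn W (f v) y * Wn W (f v') y) :=
          Finset.sum_le_sum_of_subset_of_nonneg (Finset.subset_univ _)
            fun y _ _ => Finset.sum_nonneg fun v' _ => by positivity
      _ = _ := by
          rw [Finset.sum_comm]
          refine Finset.sum_congr rfl fun v' _ => ?_
          rw [← Finset.mul_sum, sum_sqrt_Wn hW]

theorem exists_pos_le_of_ne_zero {ι : Type*} [Finite ι] (g : ι → ℝ) (hg : ∀ i, 0 ≤ g i) :
    ∃ μ : ℝ, 0 < μ ∧ μ ≤ 1 ∧ ∀ i, g i ≠ 0 → μ ≤ g i := by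
  have := Fintype.ofFinite ι
  let T : Finset ℝ := insert 1 ((Finset.univ.image g).filter fun z => z ≠ 0)
  obtain ⟨μ, hμ, hmin⟩ := Finset.exists_min_image T id ⟨1, Finset.mem_insert_self _ _⟩
  refine ⟨μ, ?_, hmin 1 (Finset.mem_insert_self _ _), fun i hi => hmin (g i) ?_⟩
  · rcases Finset.mem_insert.mp hμ with rfl | h
    · exact one_pos
    · obtain ⟨h1, h2⟩ := Finset.mem_filter.mp h
      obtain ⟨i, -, rfl⟩ := Finset.mem_image.mp h1
      exact lt_of_le_of_ne (hg i) h2.symm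
  · exact Finset.mem_insert_of_mem (Finset.mem_filter.mpr
      ⟨Finset.mem_image_of_mem g (Finset.mem_univ i), hi⟩)

/-- A nonzero error probability is at least exponentially small, with a rate that does not
depend on the code. -/
theorem exists_exp_le_pErr_of_ne_zero [Fintype X] {PV : V → ℝ} (hPV : PV ∈ stdSimplex ℝ V) {W : X → Y → ℝ}
    (hW : IsDMC W) (t : ℝ) :
    ∃ K : ℝ, ∀ (k n : ℕ) (f : (Fin k → V) → Fin n → X) (φ : (Fin n → Y) → Fin k → V),
      (k : ℝ) ≤ t * n → pErr PV W f φ ≠ 0 → Real.exp (-(n * K)) ≤ pErr PV W f φ := by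
  obtain ⟨μ, hμ0, hμ1, hμP⟩ := exists_pos_le_of_ne_zero PV hPV.1
  obtain ⟨ν, hν0, hν1, hνW⟩ := exists_pos_le_of_ne_zero (fun p : X × Y => W p.1 p.2)
    fun p => (hW p.1).1 p.2
  refine ⟨t * -Real.log μ + -Real.log ν, fun k n f φ hk hne => ?_⟩
  have hinner : ∀ v, 0 ≤ ∑ y ∈ Finset.univ.filter (fun y => φ y ≠ v), Wn W (f v) y := fun v =>
    Finset.sum_nonneg fun y _ => Wn_nonneg hW _ _
  obtain ⟨v, -, hv⟩ := Finset.exists_ne_zero_of_sum_ne_zero hne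
  obtain ⟨hv1, hv2⟩ := mul_ne_zero_iff.mp hv
  obtain ⟨y, hy, hvy⟩ := Finset.exists_ne_zero_of_sum_ne_zero hv2
  have h1 : μ ^ k ≤ prodDist PV v := by
    calc μ ^ k = ∏ _i : Fin k, μ := by simp
      _ ≤ _ := Finset.prod_le_prod (fun _ _ => hμ0.le) fun i _ =>
          hμP _ (Finset.prod_ne_zero_iff.mp hv1 i (Finset.mem_univ i))
  have h2 : ν ^ n ≤ Wn W (f v) y := by
    calc ν ^ n = ∏ _i : Fin n, ν := by simp
      _ ≤ _ := Finset.prod_le_prod (fun _ _ => hν0.le) fun i _ =>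
          hνW (f v i, y i) (Finset.prod_ne_zero_iff.mp hvy i (Finset.mem_univ i))
  have h3 : ν ^ n ≤ ∑ y ∈ Finset.univ.filter (fun y => φ y ≠ v), Wn W (f v) y :=
    h2.trans (Finset.single_le_sum (f := fun y => Wn W (f v) y) (fun y _ => Wn_nonneg hW _ _) hy)
  calc Real.exp (-(n * (t * -Real.log μ + -Real.log ν)))
      ≤ Real.exp (k * Real.log μ + n * Real.log ν) := by
        refine Real.exp_le_exp.mpr ?_
        have := mul_le_mul_of_nonneg_right hk (neg_nonneg.mpr (Real.log_nonpos hμ0.le hμ1))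
        linarith
    _ = μ ^ k * ν ^ n := by
        rw [Real.exp_add, Real.exp_nat_mul, Real.exp_nat_mul, Real.exp_log hμ0, Real.exp_log hν0]
    _ ≤ prodDist PV v * ∑ y ∈ Finset.univ.filter (fun y => φ y ≠ v), Wn W (f v) y :=
        mul_le_mul h1 h3 (by positivity) (prodDist_nonneg hPV.1 v)
    _ ≤ pErr PV W f φ := Finset.single_le_sum
        (f := fun v => prodDist PV v *
          ∑ y ∈ Finset.univ.filter (fun y => φ y ≠ v), Wn W (f v) y)
        (fun v _ => mul_nonneg (prodDist_nonneg hPV.1 v) (hinner v)) (Finset.mem_univ v)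

/-- The Bhattacharyya coefficient of two sequences in terms of their joint type. -/
theorem prod_bhattCoeff_eq_exp [Fintype X] {W : X → Y → ℝ} {n : ℕ} (x x' : Fin n → X)
    (h : ∀ l, bhattCoeff W (x l) (x' l) ≠ 0) :
    ∏ l, bhattCoeff W (x l) (x' l) = Real.exp (-(n * ∑ p : X × X,
      empDist (fun l => (x l, x' l)) p * -Real.log (bhattCoeff W p.1 p.2))) := by
  rw [← sum_comp_eq_empDist (fun l => (x l, x' l)) fun p => -Real.log (bhattCoeff W p.1 p.2),
    Finset.sum_neg_distrib, neg_neg, Real.exp_sum]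
  exact Finset.prod_congr rfl fun l _ =>
    (Real.exp_log (lt_of_le_of_ne (bhattCoeff_nonneg W _ _) (h l).symm)).symm

theorem entH_empDist_diag [Fintype X] {n : ℕ} (hn : 0 < n) (x : Fin n → X) :
    entH (empDist fun l => (x l, x l)) = entH (empDist x) := by
  have h : prodDist (empDist fun l => (x l, x l)) (fun l => (x l, x l)) =
      prodDist (empDist x) x := by
    unfold prodDist empDist
    simp only [Prod.mk.injEq, and_self]
  rw [prodDist_empDist, prodDist_empDist, Real.exp_eq_exp, neg_inj] at h
  exact mul_left_cancel₀ (by positivity) h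

theorem seqInfo_self [Fintype X] {n : ℕ} (hn : 0 < n) (x : Fin n → X) :
    seqInfo x x = entH (empDist x) := by
  unfold seqInfo
  rw [entH_empDist_diag hn]
  ring

/-- Bound on the Bhattacharyya coefficient of two sequences from a bound on joint types. -/
theorem prod_bhattCoeff_le [Fintype X] {W : X → Y → ℝ} {n : ℕ} (hn : 0 < n) {Q : X → ℝ} {A R : ℝ}
    (hbound : ∀ P ∈ stdSimplex ℝ (X × X), (∀ x, ∑ x', P (x, x') = Q x) → mutualInfo P ≤ R →
      (∀ p : X × X, bhattCoeff W p.1 p.2 = 0 → P p = 0) →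
      A ≤ (∑ p : X × X, P p * -Real.log (bhattCoeff W p.1 p.2)) + mutualInfo P - R)
    {x x' : Fin n → X} (hx : empDist x = Q) (hI : seqInfo x x' ≤ R) :
    ∏ l, bhattCoeff W (x l) (x' l) ≤ Real.exp (-(n * (A + R - seqInfo x x'))) := by
  by_cases h : ∀ l, bhattCoeff W (x l) (x' l) ≠ 0
  · rw [prod_bhattCoeff_eq_exp x x' h]
    have := hbound (empDist fun l => (x l, x' l)) (empDist_mem_stdSimplex hn _)
      (fun a => by rw [sum_empDist_prod_fst, hx]) (by rwa [mutualInfo_empDist]) (fun p hp => by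
        by_contra hne
        obtain ⟨l, rfl⟩ := exists_of_empDist_ne_zero hne
        exact h l hp)
    rw [mutualInfo_empDist] at this
    refine Real.exp_le_exp.mpr (neg_le_neg (mul_le_mul_of_nonneg_left ?_ (Nat.cast_nonneg n)))
    linarith
  · push Not at h
    obtain ⟨l, hl⟩ := h
    rw [Finset.prod_eq_zero (Finset.mem_univ l) hl]
    positivity

end Coding

section Coding

open scoped Classical

variable {V X Y : Type*} [Fintype V] [Fintype X] [Fintype Y]

/-- Code construction at a fixed block length: a common packing of all codewords, with the
composition of each source type chosen according to the primal bound. Source types that are too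
unlikely to matter all get the composition with index `c₀`. -/
theorem exists_code {PV : V → ℝ} (hPV : PV ∈ stdSimplex ℝ V) {W : X → Y → ℝ} (hW : IsDMC W)
    {t : ℝ} {m : ℕ} {Qs : Fin m → X → ℝ} {E δ : ℝ} (hδ : 0 < δ)
    (hE : PrimalBoundNear PV W t Qs E δ) {k n : ℕ} (hk : 0 < k) (hn : 0 < n)
    (hkn : |(k : ℝ) / n - t| ≤ δ) {Qc : Fin m → X → ℝ} (hQc : ∀ c, IsType n (Qc c))
    (hQcs : ∀ c x, |Qc c x - Qs c x| ≤ δ) (c₀ : Fin m)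
    (hpoly : ((n : ℝ) + 1) ^ Fintype.card (X × X) * (Real.exp 1 * (n + 1)) ^ Fintype.card X *
      ((k : ℝ) + 1) ^ Fintype.card V ≤ Real.exp (n * δ)) :
    ∃ (cls : (Fin k → V) → Fin m) (f : (Fin k → V) → Fin n → X) (φ : (Fin n → Y) → Fin k → V),
      (∀ v v', empDist v = empDist v' → cls v = cls v') ∧
      (∀ v, f v ∈ typeClass n (Qc (cls v))) ∧
      (∀ c ≠ c₀, ((Finset.univ.filter fun v => cls v = c).card : ℝ) ≤
        ((k : ℝ) + 1) ^ Fintype.card V * Real.exp (n * (entH (Qc c) - δ))) ∧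
      pErr PV W f φ ≤ 2 * ((k : ℝ) + 1) ^ Fintype.card V * Real.exp (-(n * E)) := by
  have hn' : (0 : ℝ) < n := by exact_mod_cast hn
  set s : ℝ := (k : ℝ) / n with hs
  have hsn : n * s = k := by rw [hs]; field_simp
  let D : (V → ℝ) → ℝ := fun Q => ∑ a, Q a * Real.log (Q a / PV a)
  let good : (V → ℝ) → Prop := fun Q => (∀ a, PV a = 0 → Q a = 0) ∧ s * D Q < E
  have hchoice : ∀ Q : V → ℝ, ∃ c, (Q ∈ stdSimplex ℝ V → good Q →
      ∀ P ∈ stdSimplex ℝ (X × X), (∀ x, ∑ x', P (x, x') = Qc c x) →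
        mutualInfo P ≤ s * entH Q + δ →
        (∀ p : X × X, bhattCoeff W p.1 p.2 = 0 → P p = 0) →
        E - s * D Q ≤ (∑ p : X × X, P p * -Real.log (bhattCoeff W p.1 p.2)) + mutualInfo P
          - (s * entH Q + δ)) ∧ (¬ good Q → c = c₀) := by
    intro Q
    by_cases hg : Q ∈ stdSimplex ℝ V ∧ good Q
    · obtain ⟨c, hc⟩ := hE s (s * entH Q + δ) Q Qc hkn hg.1 hg.2.1
        (by rw [add_sub_cancel_left, abs_of_pos hδ]) hQcs
      refine ⟨c, fun _ _ P hP h1 h2 h3 => ?_, fun h => absurd hg.2 h⟩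
      have := hc P hP h1 h2 h3
      linarith
    · exact ⟨c₀, fun h1 h2 => absurd ⟨h1, h2⟩ hg, fun _ => rfl⟩
  choose clsOf hcls hcls₀ using hchoice
  let w : (Fin k → V) → ℝ := fun v => Real.exp (-(k * entH (empDist v)))
  have hwpos : ∀ v, 0 < w v := fun v => Real.exp_pos _
  have hwsum : ∑ v, w v ≤ ((k : ℝ) + 1) ^ Fintype.card V := sum_exp_neg_entH_le hk
  have hsimp : ∀ v : Fin k → V, empDist v ∈ stdSimplex ℝ V := empDist_mem_stdSimplex hk
  obtain ⟨f, hfS, hf⟩ := exists_forall_sum_le_of_average_le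
    (fun v : Fin k → V => typeClass n (Qc (clsOf (empDist v))))
    (fun v => by
      obtain ⟨x, hx⟩ := hQc (clsOf (empDist v))
      exact ⟨x, Finset.mem_filter.mpr ⟨Finset.mem_univ _, hx⟩⟩)
    w hwpos (fun x x' => Real.exp (n * seqInfo x x'))
    (fun x x' => by rw [seqInfo_comm])
    (((n : ℝ) + 1) ^ Fintype.card (X × X) * (Real.exp 1 * (n + 1)) ^ Fintype.card X)
    (by positivity) (fun v x => sum_exp_seqInfo_le hn (hQc _) x)
  have hf' : ∀ v, ∑ v' ∈ Finset.univ.erase v, w v' * Real.exp (n * seqInfo (f v) (f v')) ≤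
      Real.exp (n * δ) := fun v =>
    (hf v).trans ((mul_le_mul_of_nonneg_left hwsum (by positivity)).trans hpoly)
  have hemp : ∀ v, empDist (f v) = Qc (clsOf (empDist v)) := fun v =>
    (Finset.mem_filter.mp (hfS v)).2
  have hinfo : ∀ v v', v' ≠ v → seqInfo (f v) (f v') ≤ s * entH (empDist v') + δ := by
    intro v v' hne
    have h1 := (Finset.single_le_sum
      (f := fun v' => w v' * Real.exp (n * seqInfo (f v) (f v')))
      (fun u _ => mul_nonneg (hwpos u).le (Real.exp_pos _).le)
      (Finset.mem_erase.mpr ⟨hne, Finset.mem_univ v'⟩)).trans (hf' v)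
    simp only [w] at h1
    rw [← Real.exp_add, Real.exp_le_exp, ← hsn] at h1
    refine le_of_mul_le_mul_left ?_ hn'
    linarith
  have hbh : ∀ v v', v' ≠ v → good (empDist v) →
      ∏ l, bhattCoeff W (f v l) (f v' l) ≤ Real.exp (-(n * (E - s * D (empDist v) +
        (s * entH (empDist v) + δ) - seqInfo (f v) (f v')))) := by
    intro v v' hne hg
    refine prod_bhattCoeff_le hn (hcls (empDist v) (hsimp v) hg) (hemp v) ?_
    rw [seqInfo_comm]
    exact hinfo v' v hne.symm
  have hprob : ∀ v : Fin k → V, good (empDist v) →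
      prodDist PV v = Real.exp (-(n * (s * D (empDist v) + s * entH (empDist v)))) := by
    intro v hg
    rw [prodDist_eq_exp hPV.1 v hg.1, ← mul_add, ← mul_assoc, hsn]
  let G : Finset (Fin k → V) := Finset.univ.filter fun v => good (empDist v)
  obtain ⟨φ, hφ⟩ := exists_decoder_pErr_le hPV hW f G
  refine ⟨fun v => clsOf (empDist v), f, φ, fun v v' h => by simp only [h], hfS,
    fun c hc => ?_, hφ.trans ?_⟩
  · have hent : ∀ v, clsOf (empDist v) = c → 1 ≤ Real.exp (n * (entH (Qc c) - δ)) * w v := by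
      intro v hv
      have hg : good (empDist v) := by
        by_contra h
        exact hc (hv.symm.trans (hcls₀ _ h))
      have hlt : s * entH (empDist v) + δ < entH (Qc c) := by
        by_contra hle
        push Not at hle
        obtain ⟨x, hx⟩ := hQc c
        have hself := seqInfo_self hn x
        have hb := prod_bhattCoeff_le (x := x) (x' := x) hn (hcls (empDist v) (hsimp v) hg)
          (hx.trans (by rw [hv])) (by rw [hself, hx]; exact hle)
        rw [Finset.prod_eq_one fun l _ => bhattCoeff_self hW (x l), hself, hx,
          ← Real.exp_zero, Real.exp_le_exp, neg_nonneg] at hb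
        have hpos := hg.2
        have : 0 < n * (E - s * D (empDist v) + (s * entH (empDist v) + δ) - entH (Qc c)) :=
          mul_pos hn' (by linarith)
        linarith
      simp only [w]
      rw [← Real.exp_add, ← Real.exp_zero, Real.exp_le_exp, ← hsn]
      have := mul_pos hn' (sub_pos.mpr hlt)
      linarith
    calc ((Finset.univ.filter fun v : Fin k → V => clsOf (empDist v) = c).card : ℝ)
        = ∑ v ∈ Finset.univ.filter (fun v : Fin k → V => clsOf (empDist v) = c), (1 : ℝ) := by
          simp
      _ ≤ ∑ v ∈ Finset.univ.filter (fun v : Fin k → V => clsOf (empDist v) = c),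
            Real.exp (n * (entH (Qc c) - δ)) * w v :=
          Finset.sum_le_sum fun v hv => hent v (Finset.mem_filter.mp hv).2
      _ ≤ ∑ v, Real.exp (n * (entH (Qc c) - δ)) * w v :=
          Finset.sum_le_sum_of_subset_of_nonneg (Finset.subset_univ _) fun v _ _ =>
            mul_nonneg (Real.exp_pos _).le (hwpos v).le
      _ ≤ _ := by
          rw [← Finset.mul_sum, mul_comm]
          gcongr
  · have hbad : ∀ v ∈ Gᶜ, prodDist PV v ≤ Real.exp (-(n * E)) * w v := by
      intro v hv
      have hng : ¬ good (empDist v) := by simpa [G] using hv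
      by_cases hac : ∀ a, PV a = 0 → empDist v a = 0
      · have hD : E ≤ s * D (empDist v) := by
          by_contra h
          exact hng ⟨hac, not_le.mp h⟩
        rw [prodDist_eq_exp hPV.1 v hac]
        simp only [w]
        rw [← Real.exp_add, Real.exp_le_exp]
        have := mul_le_mul_of_nonneg_left hD hn'.le
        rw [← mul_assoc, hsn] at this
        simp only [D] at this
        linarith
      · rw [prodDist_eq_zero v hac]
        exact mul_nonneg (Real.exp_pos _).le (hwpos v).le
    have hpair : ∀ v ∈ G, ∀ v' ∈ G.erase v, Real.sqrt (prodDist PV v * prodDist PV v') *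
        ∏ l, bhattCoeff W (f v l) (f v' l) ≤
        (Real.exp (-(n * E)) * Real.exp (-(n * δ)) * w v) *
          (w v' * Real.exp (n * seqInfo (f v) (f v'))) := by
      intro v hv v' hv'
      have hg : good (empDist v) := (Finset.mem_filter.mp hv).2
      have hg' : good (empDist v') := (Finset.mem_filter.mp (Finset.mem_of_mem_erase hv')).2
      have hne : v' ≠ v := Finset.ne_of_mem_erase hv'
      have hb := hbh v v' hne hg
      have hb' := hbh v' v hne.symm hg'
      rw [seqInfo_comm, Finset.prod_congr rfl fun l _ => bhattCoeff_comm W (f v' l) (f v l)] at hb'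
      set b := ∏ l, bhattCoeff W (f v l) (f v' l)
      have hb0 : 0 ≤ b := Finset.prod_nonneg fun l _ => bhattCoeff_nonneg W _ _
      have hbb : b = Real.sqrt (b * b) := (Real.sqrt_mul_self hb0).symm
      have hrhs : (Real.exp (-(n * E)) * Real.exp (-(n * δ)) * w v) *
          (w v' * Real.exp (n * seqInfo (f v) (f v'))) = Real.exp (-(n * E) + -(n * δ) +
            -(k * entH (empDist v)) + (-(k * entH (empDist v')) +
              n * seqInfo (f v) (f v'))) := by
        simp only [w, Real.exp_add]
      rw [hrhs, hbb, ← Real.sqrt_mul (mul_nonneg (prodDist_nonneg hPV.1 v)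
        (prodDist_nonneg hPV.1 v')), hprob v hg, hprob v' hg']
      refine Real.sqrt_le_iff.mpr ⟨(Real.exp_pos _).le, ?_⟩
      refine (mul_le_mul_of_nonneg_left (mul_le_mul hb hb' hb0 (Real.exp_pos _).le)
        (by positivity)).trans (le_of_eq ?_)
      rw [← Real.exp_add, ← Real.exp_add, ← Real.exp_add, sq, ← Real.exp_add, ← hsn]
      congr 1
      ring
    have hsum1 : ∑ v ∈ Gᶜ, prodDist PV v ≤
        Real.exp (-(n * E)) * ((k : ℝ) + 1) ^ Fintype.card V := by
      calc _ ≤ ∑ v ∈ Gᶜ, Real.exp (-(n * E)) * w v := Finset.sum_le_sum hbad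
        _ ≤ ∑ v, Real.exp (-(n * E)) * w v :=
            Finset.sum_le_sum_of_subset_of_nonneg (Finset.subset_univ _) fun v _ _ =>
              mul_nonneg (Real.exp_pos _).le (hwpos v).le
        _ ≤ _ := by rw [← Finset.mul_sum]; gcongr
    have hsum2 : ∑ v ∈ G, ∑ v' ∈ G.erase v, Real.sqrt (prodDist PV v * prodDist PV v') *
        ∏ l, bhattCoeff W (f v l) (f v' l) ≤
        Real.exp (-(n * E)) * ((k : ℝ) + 1) ^ Fintype.card V := by
      calc _ ≤ ∑ v ∈ G, Real.exp (-(n * E)) * w v := by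
            refine Finset.sum_le_sum fun v hv => ?_
            calc _ ≤ ∑ v' ∈ G.erase v, (Real.exp (-(n * E)) * Real.exp (-(n * δ)) * w v) *
                    (w v' * Real.exp (n * seqInfo (f v) (f v'))) :=
                  Finset.sum_le_sum (hpair v hv)
              _ ≤ ∑ v' ∈ Finset.univ.erase v,
                    (Real.exp (-(n * E)) * Real.exp (-(n * δ)) * w v) *
                    (w v' * Real.exp (n * seqInfo (f v) (f v'))) :=
                  Finset.sum_le_sum_of_subset_of_nonneg
                    (Finset.erase_subset_erase _ (Finset.subset_univ _))
                    fun v' _ _ => by positivity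
              _ ≤ (Real.exp (-(n * E)) * Real.exp (-(n * δ)) * w v) * Real.exp (n * δ) := by
                  rw [← Finset.mul_sum]
                  exact mul_le_mul_of_nonneg_left (hf' v) (by positivity)
              _ = Real.exp (-(n * E)) * w v * (Real.exp (-(n * δ)) * Real.exp (n * δ)) := by ring
              _ = _ := by rw [← Real.exp_add (-(n * δ)), neg_add_cancel, Real.exp_zero, mul_one]
        _ ≤ ∑ v, Real.exp (-(n * E)) * w v :=
            Finset.sum_le_sum_of_subset_of_nonneg (Finset.subset_univ _) fun v _ _ =>
              mul_nonneg (Real.exp_pos _).le (hwpos v).le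
        _ ≤ _ := by rw [← Finset.mul_sum]; gcongr
    linarith

end Coding

section Asymptotics

open scoped Classical
open Filter

theorem eventually_pow_le_exp {C γ : ℝ} (hC : 0 < C) (hγ : 0 < γ) (A : ℕ) :
    ∀ᶠ n : ℕ in atTop, (C * ((n : ℝ) + 1)) ^ A ≤ Real.exp (n * γ) := by
  have h := ((isLittleO_pow_exp_pos_mul_atTop (k := A) hγ).comp_tendsto
    (tendsto_natCast_atTop_atTop (R := ℝ))).def (c := ((2 * C) ^ A)⁻¹) (by positivity)
  filter_upwards [h, eventually_ge_atTop 1] with n hn h1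
  have h1' : (1 : ℝ) ≤ n := by exact_mod_cast h1
  simp only [Function.comp, norm_pow, Real.norm_eq_abs, Real.abs_exp, Nat.abs_cast] at hn
  rw [← div_eq_inv_mul, le_div_iff₀ (by positivity), ← mul_pow, mul_comm γ] at hn
  refine le_trans (pow_le_pow_left₀ (by positivity) ?_ A) hn
  nlinarith

variable {V X Y : Type*} [Fintype V] [Fintype X] [Fintype Y]

/-- A composition with enough room for all source sequences, if there is one. -/
theorem exists_index_entH_near (t : ℝ) {m : ℕ} (hm : 0 < m) (Qs : Fin m → X → ℝ) (L : ℝ) :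
    ∃ (c₀ : Fin m) (γ ρ : ℝ), 0 < γ ∧ 0 < ρ ∧ ((∃ c, t * L < entH (Qs c)) →
      ∀ Q' : X → ℝ, (∀ x, |Q' x - Qs c₀ x| ≤ ρ) → t * L + γ ≤ entH Q') := by
  by_cases h : ∃ c, t * L < entH (Qs c)
  · obtain ⟨c, hc⟩ := h
    obtain ⟨ρ, hρ, hcont⟩ := Metric.continuousAt_iff.mp
      (continuous_entH.continuousAt (x := Qs c)) ((entH (Qs c) - t * L) / 2) (by linarith)
    refine ⟨c, (entH (Qs c) - t * L) / 2, ρ / 2, by linarith, by linarith, fun _ Q' hQ' => ?_⟩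
    have hd : dist Q' (Qs c) < ρ :=
      lt_of_le_of_lt ((dist_pi_le_iff (by linarith)).mpr hQ') (by linarith)
    have := (abs_lt.mp (hcont hd)).1
    linarith
  · exact ⟨⟨0, hm⟩, 1, 1, one_pos, one_pos, fun h' => absurd h' h⟩

/-- Achievability of every exponent below one that satisfies the primal bound near `Qs`. -/
theorem exists_code_of_primalBoundNear {PV : V → ℝ} (hPV : PV ∈ stdSimplex ℝ V) {W : X → Y → ℝ}
    (hW : IsDMC W) {t : ℝ} (ht : 0 < t) {m : ℕ} (hm : 0 < m) {Qs : Fin m → X → ℝ}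
    (hQs : ∀ c, Qs c ∈ stdSimplex ℝ X) {E δ : ℝ} (hδ : 0 < δ)
    (hE : PrimalBoundNear PV W t Qs E δ) {ε : ℝ} (hε : 0 < ε) :
    ∃ n₀ : ℕ, ∀ n : ℕ, n₀ ≤ n → 0 < n ∧
      ∃ (cls : (Fin ⌊t * (n : ℝ)⌋₊ → V) → Fin m) (Qc : Fin m → X → ℝ),
        IsTypePartition n cls Qc ∧
        (∀ c x, |Qc c x - Qs c x| ≤ ε) ∧
        ((∃ c, t * Real.log (Fintype.card V) < entH (Qs c)) → AdmissiblePartition n cls Qc) ∧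
        ∃ (f : (Fin ⌊t * (n : ℝ)⌋₊ → V) → Fin n → X)
          (φ : (Fin n → Y) → Fin ⌊t * (n : ℝ)⌋₊ → V),
          (∀ v, f v ∈ typeClass n (Qc (cls v))) ∧
          pErr PV W f φ ≤ Real.exp (-(n * (E - ε))) := by
  have hV : 0 < Fintype.card V := by
    rw [Fintype.card_pos_iff]
    by_contra h
    rw [not_nonempty_iff] at h
    simpa using hPV.2
  obtain ⟨c₀, γ, ρ, hγ, hρ, hroom⟩ := exists_index_entH_near t hm Qs (Real.log (Fintype.card V))
  have hlarge : ∀ {a b : ℝ}, 0 < b → ∀ᶠ n : ℕ in atTop, a / n ≤ b := fun {a b} hb =>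
    (tendsto_const_div_atTop_nhds_zero_nat a).eventually (ge_mem_nhds hb)
  rw [← eventually_atTop]
  filter_upwards [eventually_gt_atTop 0, hlarge (a := 1) ht, hlarge (a := 1) hδ,
    hlarge (a := Fintype.card X) hδ, hlarge (a := Fintype.card X) hε,
    hlarge (a := Fintype.card X) hρ,
    eventually_pow_le_exp (C := t + 3) (by linarith) hδ
      (Fintype.card (X × X) + Fintype.card X + Fintype.card V),
    eventually_pow_le_exp (C := t + 3) (by linarith) hε (Fintype.card V + 1),
    eventually_pow_le_exp (C := t + 3) (by linarith) hγ (Fintype.card X)]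
    with n hn hnt hnδ hXδ hXε hXρ hpolyδ hpolyε hpolyγ
  refine ⟨hn, ?_⟩
  have hn' : (0 : ℝ) < n := by exact_mod_cast hn
  set k := ⌊t * (n : ℝ)⌋₊ with hkdef
  have hkle : (k : ℝ) ≤ t * n := Nat.floor_le (by positivity)
  have hklt : t * n < k + 1 := Nat.lt_floor_add_one _
  have hk : 0 < k := by
    rw [hkdef, Nat.floor_pos]
    exact (div_le_iff₀ hn').mp hnt
  have hkn : |(k : ℝ) / n - t| ≤ δ := by
    have h1 : (k : ℝ) / n ≤ t := (div_le_iff₀ hn').mpr hkle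
    have h2 : t ≤ (k : ℝ) / n + 1 / n := by
      rw [← add_div, le_div_iff₀ hn']
      exact hklt.le
    rw [abs_le]
    constructor <;> linarith
  have hB1 : (n : ℝ) + 1 ≤ (t + 3) * (n + 1) := by nlinarith
  have hBe : Real.exp 1 * (n + 1) ≤ (t + 3) * (n + 1) := by
    have := Real.exp_one_lt_d9
    gcongr
    linarith
  have hBk : (k : ℝ) + 1 ≤ (t + 3) * (n + 1) := by nlinarith
  choose Qc hQc hQcs using fun c => exists_isType_near (hQs c) hn
  have hpoly : ((n : ℝ) + 1) ^ Fintype.card (X × X) * (Real.exp 1 * (n + 1)) ^ Fintype.card X *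
      ((k : ℝ) + 1) ^ Fintype.card V ≤ Real.exp (n * δ) := by
    refine le_trans ?_ hpolyδ
    rw [pow_add, pow_add]
    gcongr
  obtain ⟨cls, f, φ, hcls, hf, hcard, herr⟩ := exists_code hPV hW hδ hE hk hn hkn hQc
    (fun c x => (hQcs c x).trans hXδ) c₀ hpoly
  refine ⟨cls, Qc, ⟨hcls, hQc⟩, fun c x => (hQcs c x).trans hXε,
    fun hex => ⟨⟨hcls, hQc⟩, fun c => ?_⟩, f, φ, hf, ?_⟩
  · have hT := exp_entH_le_card_typeClass hn (hQc c)
    have hC : (0 : ℝ) < (Real.exp 1 * (n + 1)) ^ Fintype.card X := by positivity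
    suffices h : ((Finset.univ.filter fun v : Fin k → V => cls v = c).card : ℝ) ≤
        (typeClass n (Qc c)).card by exact_mod_cast h
    refine le_of_mul_le_mul_left (le_trans ?_ hT) hC
    by_cases hc : c = c₀
    · subst hc
      have hall : ((Finset.univ.filter fun v : Fin k → V => cls v = c).card : ℝ) ≤
          Real.exp (n * (t * Real.log (Fintype.card V))) := by
        calc _ ≤ ((Fintype.card V : ℝ)) ^ k := by
              have := Finset.card_le_univ (Finset.univ.filter fun v : Fin k → V => cls v = c)
              rw [Fintype.card_fun, Fintype.card_fin] at this
              exact_mod_cast this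
          _ = Real.exp (k * Real.log (Fintype.card V)) := by
              rw [Real.exp_nat_mul, Real.exp_log (by exact_mod_cast hV)]
          _ ≤ _ := by
              refine Real.exp_le_exp.mpr ?_
              have hlog : 0 ≤ Real.log (Fintype.card V) :=
                Real.log_nonneg (by exact_mod_cast hV)
              have := mul_le_mul_of_nonneg_right hkle hlog
              linarith
      have hH := hroom hex (Qc c) fun x => (hQcs c x).trans hXρ
      calc _ ≤ Real.exp (n * γ) * Real.exp (n * (t * Real.log (Fintype.card V))) := by
            refine mul_le_mul (le_trans ?_ hpolyγ) hall (Nat.cast_nonneg _) (Real.exp_pos _).le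
            gcongr
        _ ≤ _ := by
            rw [← Real.exp_add, Real.exp_le_exp, ← mul_add]
            refine mul_le_mul_of_nonneg_left ?_ hn'.le
            linarith
    · have hle : (Real.exp 1 * (n + 1)) ^ Fintype.card X * ((k : ℝ) + 1) ^ Fintype.card V ≤
          Real.exp (n * δ) := by
        refine le_trans ?_ hpoly
        rw [mul_assoc]
        exact le_mul_of_one_le_left (by positivity) (one_le_pow₀ (by linarith))
      calc _ ≤ (Real.exp 1 * (n + 1)) ^ Fintype.card X *
              (((k : ℝ) + 1) ^ Fintype.card V * Real.exp (n * (entH (Qc c) - δ))) := by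
            refine mul_le_mul_of_nonneg_left ?_ hC.le
            convert hcard c hc
        _ ≤ Real.exp (n * δ) * Real.exp (n * (entH (Qc c) - δ)) := by
            rw [← mul_assoc]
            gcongr
        _ = _ := by
            rw [← Real.exp_add]
            congr 1
            ring
  · refine herr.trans ?_
    calc 2 * ((k : ℝ) + 1) ^ Fintype.card V * Real.exp (-(n * E))
        ≤ Real.exp (n * ε) * Real.exp (-(n * E)) := by
          gcongr
          refine le_trans ?_ hpolyε
          rw [pow_succ, mul_comm]
          gcongr
          nlinarith
      _ = _ := by
          rw [← Real.exp_add]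
          congr 1
          ring

end Asymptotics

/-- The primal exponent is achievable by codes built from a partition of `𝒱^k` into `m` unions of
source type classes with compositions approximating `Q₁, …, Qₘ`. If the type classes of
the `Qs c` have asymptotically enough room for `𝒱^k`, the partition is moreover admissible. -/
theorem stmt1 {V X Y : Type*} [Fintype V] [Fintype X] [Fintype Y]
    (PV : V → ℝ) (hPV : PV ∈ stdSimplex ℝ V) (W : X → Y → ℝ) (hW : IsDMC W)
    (t : ℝ) (ht : 0 < t) (m : ℕ) (hm : 0 < m)
    (Qs : Fin m → X → ℝ) (hQs : ∀ c, Qs c ∈ stdSimplex ℝ X)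
    (ε : ℝ) (hε : 0 < ε) :
    ∃ n₀ : ℕ, ∀ n : ℕ, n₀ ≤ n →
      ∃ (cls : (Fin ⌊t * (n : ℝ)⌋₊ → V) → Fin m) (Qc : Fin m → X → ℝ),
        IsTypePartition n cls Qc ∧
        (∀ c x, |Qc c x - Qs c x| ≤ ε) ∧
        ((∃ c, t * Real.log (Fintype.card V) < entH (Qs c)) → AdmissiblePartition n cls Qc) ∧
        ∃ (f : (Fin ⌊t * (n : ℝ)⌋₊ → V) → Fin n → X)
          (φ : (Fin n → Y) → Fin ⌊t * (n : ℝ)⌋₊ → V),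
          (∀ v, f v ∈ typeClass n (Qc (cls v))) ∧
          ENNReal.ofReal (pErr PV W f φ) ≤
            EReal.exp (-(((n : ℝ) : EReal) * (EJexPrimal PV W t Qs - (ε : EReal)))) := by
  induction hEJ : EJexPrimal PV W t Qs using EReal.rec with
  | bot =>
    obtain ⟨E, δ, hδ, hE⟩ := exists_primalBoundNear_of_pos hPV hW ht hm Qs
    obtain ⟨n₀, h⟩ := exists_code_of_primalBoundNear hPV hW ht hm hQs hδ hE hε
    refine ⟨n₀, fun n hn => ?_⟩
    obtain ⟨hn0, cls, Qc, h1, h2, h3, f, φ, h4, -⟩ := h n hn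
    refine ⟨cls, Qc, h1, h2, h3, f, φ, h4, ?_⟩
    have hn0' : (0 : ℝ) < n := by exact_mod_cast hn0
    rw [EReal.bot_sub, EReal.coe_mul_bot_of_pos hn0', EReal.neg_bot, EReal.exp_top]
    exact le_top
  | coe e =>
    obtain ⟨δ, hδ, hE⟩ := exists_primalBoundNear (E₀ := e) ht hEJ.ge (half_pos hε)
    obtain ⟨n₀, h⟩ := exists_code_of_primalBoundNear hPV hW ht hm hQs hδ hE (half_pos hε)
    refine ⟨n₀, fun n hn => ?_⟩
    obtain ⟨hn0, cls, Qc, h1, h2, h3, f, φ, h4, h5⟩ := h n hn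
    refine ⟨cls, Qc, h1, fun c x => (h2 c x).trans (by linarith), h3, f, φ, h4, ?_⟩
    rw [← EReal.coe_sub, ← EReal.coe_mul, ← EReal.coe_neg, EReal.exp_coe]
    refine ENNReal.ofReal_le_ofReal (h5.trans_eq ?_)
    congr 1
    ring
  | top =>
    obtain ⟨K, hK⟩ := exists_exp_le_pErr_of_ne_zero hPV hW t
    obtain ⟨δ, hδ, hE⟩ := exists_primalBoundNear (E₀ := K + 1 + ε + ε) ht (hEJ ▸ le_top) hε
    obtain ⟨n₀, h⟩ := exists_code_of_primalBoundNear hPV hW ht hm hQs hδ hE hε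
    refine ⟨n₀, fun n hn => ?_⟩
    obtain ⟨hn0, cls, Qc, h1, h2, h3, f, φ, h4, h5⟩ := h n hn
    refine ⟨cls, Qc, h1, h2, h3, f, φ, h4, ?_⟩
    have hn0' : (0 : ℝ) < n := by exact_mod_cast hn0
    have hzero : pErr PV W f φ = 0 := by
      by_contra hne
      have hle := (hK _ n f φ (Nat.floor_le (by positivity)) hne).trans h5
      rw [Real.exp_le_exp] at hle
      linarith
    rw [hzero, ENNReal.ofReal_zero]
    exact zero_le
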